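/- arXiv:2001.05067 — 3 statements merged into one kernel-verified Lean document; each statement's English description precedes it below -/
import Mathlib

section
/- Let R and F be C² positive real functions on an open interval (a₁,a₂), and Ê > 0. For κ ∈ (a₁,a₂) and small |ε|, let A₋(ε,Ê,κ) < A₊(ε,Ê,κ) be the simple roots of 2Ê − F(κ − εu)u² = 0 near ∓√(2Ê/F(κ)), and define G(ε, Ê, κ) = √2 · ∫_{A₋(ε,Ê,κ)}^{A₊(ε,Ê,κ)} [ R'(κ − εu)·√(Ê − F(κ − εu)u²/2) / R(κ − εu)^{3/2} + F'(κ − εu)·(u²/2) / (√(R(κ − εu)) · √(Ê − F(κ − εu)u²/2)) ] du. Then for every κ ∈ (a₁,a₂), lim_{ε→0} G(ε, Ê, κ) = −2πÊ · (d/dκ)( (R(κ)F(κ))^{−1/2} ). Consequently, if for every κ ∈ (a₁,a₂) one has G(ε, Ê, κ) = 0 for all sufficiently small ε > 0, then the product R·F is constant on (a₁,a₂). -/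
open Real MeasureTheory Filter Topology

lemma mono_est (g : ℝ → ℝ) (κ r m K B ε : ℝ)
    (hlip : ∀ x ∈ Metric.ball κ r, ∀ y ∈ Metric.ball κ r, |g x - g y| ≤ K * |x - y|)
    (hm : ∀ x ∈ Metric.ball κ r, m ≤ g x) (hK : 0 ≤ K)
    (h1 : |ε| * B < r) (h2 : K * |ε| * B ≤ m / 2)
    (x y : ℝ) (hx : |x| ≤ B) (hy : |y| ≤ B) (hxy : x ≤ y) :
    m / 2 * (y - x) ≤ y * g (κ - ε * y) - x * g (κ - ε * x) := by
  have hb : ∀ z, |z| ≤ B → κ - ε * z ∈ Metric.ball κ r := by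
    intro z hz
    rw [Metric.mem_ball, Real.dist_eq]
    have : κ - ε * z - κ = -(ε * z) := by ring
    rw [this, abs_neg, abs_mul]
    exact lt_of_le_of_lt (mul_le_mul_of_nonneg_left hz (abs_nonneg _)) h1
  have e1 := hlip _ (hb x hx) _ (hb y hy)
  have e2 := hm _ (hb y hy)
  have e3 : κ - ε * x - (κ - ε * y) = ε * (y - x) := by ring
  rw [e3, abs_mul, abs_of_nonneg (sub_nonneg.2 hxy)] at e1
  have e4 : x * (g (κ - ε * x) - g (κ - ε * y)) ≤ m / 2 * (y - x) := by
    calc x * (g (κ - ε * x) - g (κ - ε * y)) ≤ |x| * |g (κ - ε * x) - g (κ - ε * y)| := by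
          rw [← abs_mul]; exact le_abs_self _
      _ ≤ B * (K * (|ε| * (y - x))) := by
          apply mul_le_mul hx e1 (abs_nonneg _) ((abs_nonneg _).trans hx)
      _ = (K * |ε| * B) * (y - x) := by ring
      _ ≤ m / 2 * (y - x) := mul_le_mul_of_nonneg_right h2 (sub_nonneg.2 hxy)
  have e5 : m * (y - x) ≤ g (κ - ε * y) * (y - x) :=
    mul_le_mul_of_nonneg_right e2 (sub_nonneg.2 hxy)
  linarith

lemma root_est (F : ℝ → ℝ) (E κ r m K B ε a b : ℝ) (hm0 : 0 < m)
    (hF : ∀ x ∈ Metric.ball κ r, 0 < F x)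
    (hlip : ∀ x ∈ Metric.ball κ r, ∀ y ∈ Metric.ball κ r, |√(F x) - √(F y)| ≤ K * |x - y|)
    (hm : ∀ x ∈ Metric.ball κ r, m ≤ √(F x)) (hK : 0 ≤ K)
    (h1 : |ε| * B < r) (h2 : K * |ε| * B ≤ m / 2)
    (ha : a < 0) (hb : 0 < b) (haB : |a| ≤ B) (hbB : |b| ≤ B)
    (hra : 2 * E - F (κ - ε * a) * a ^ 2 = 0) (hrb : 2 * E - F (κ - ε * b) * b ^ 2 = 0)
    (u : ℝ) (hau : a ≤ u) (hub : u ≤ b) :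
    m ^ 2 / 8 * ((b - u) * (u - a)) ≤ E - F (κ - ε * u) * u ^ 2 / 2 := by
  have hball : ∀ z, |z| ≤ B → κ - ε * z ∈ Metric.ball κ r := by
    intro z hz
    rw [Metric.mem_ball, Real.dist_eq]
    have : κ - ε * z - κ = -(ε * z) := by ring
    rw [this, abs_neg, abs_mul]
    exact lt_of_le_of_lt (mul_le_mul_of_nonneg_left hz (abs_nonneg _)) h1
  have huB : |u| ≤ B := by
    rw [abs_le] at *
    constructor <;> linarith
  have m1 := mono_est (fun x => √(F x)) κ r m K B ε hlip hm hK h1 h2 a u haB huB hau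
  have m2 := mono_est (fun x => √(F x)) κ r m K B ε hlip hm hK h1 h2 u b huB hbB hub
  have sq : ∀ z, |z| ≤ B → (z * √(F (κ - ε * z))) ^ 2 = F (κ - ε * z) * z ^ 2 := by
    intro z hz
    rw [mul_pow, Real.sq_sqrt (hF _ (hball z hz)).le]; ring
  have sa := sq a haB
  have sb := sq b hbB
  have su := sq u huB
  have pa : a * √(F (κ - ε * a)) < 0 :=
    mul_neg_of_neg_of_pos ha (Real.sqrt_pos.2 (hF _ (hball a haB)))
  have pb : 0 < b * √(F (κ - ε * b)) :=
    mul_pos hb (Real.sqrt_pos.2 (hF _ (hball b hbB)))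
  generalize a * √(F (κ - ε * a)) = α at *
  generalize b * √(F (κ - ε * b)) = β at *
  generalize u * √(F (κ - ε * u)) = w at *
  have hαβ : α = -β := by
    have : (β - α) * (β + α) = 0 := by linear_combination sb - sa + hra - hrb
    rcases mul_eq_zero.1 this with h | h <;> linarith
  have hprod : (m / 2 * (b - u)) * (m / 2 * (u - a)) ≤ (β - w) * (w - α) := by
    apply mul_le_mul m2 m1
    · exact mul_nonneg (by linarith) (by linarith)
    · exact le_trans (mul_nonneg (by linarith) (by linarith)) m2
  subst hαβ
  nlinarith

lemma integrable_inv_sqrt :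
    IntervalIntegrable (fun x : ℝ => 1 / √(1 - x ^ 2)) volume (-1) 1 := by
  apply intervalIntegral.intervalIntegrable_deriv_of_nonneg (g := Real.arcsin)
    Real.continuous_arcsin.continuousOn
  · intro x hx
    norm_num at hx
    exact Real.hasDerivAt_arcsin (by linarith [hx.1]) (by linarith [hx.2])
  · intro x hx; positivity

lemma integral_inv_sqrt : ∫ x in (-1 : ℝ)..1, 1 / √(1 - x ^ 2) = π := by
  rw [intervalIntegral.integral_eq_sub_of_hasDerivAt_of_le (f := Real.arcsin) (by norm_num)
    Real.continuous_arcsin.continuousOn _ integrable_inv_sqrt]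
  · simp
  · intro x hx
    exact Real.hasDerivAt_arcsin (by linarith [hx.1]) (by linarith [hx.2])

lemma limit_integral (P Q : ℝ) :
    ∫ x in (-1 : ℝ)..1, (P * √(1 - x ^ 2) + Q * (1 / √(1 - x ^ 2) - √(1 - x ^ 2)))
      = (P + Q) * (π / 2) := by
  have i2 : IntervalIntegrable (fun x : ℝ => √(1 - x ^ 2)) volume (-1) 1 :=
    (by fun_prop : Continuous (fun x : ℝ => √(1 - x ^ 2))).intervalIntegrable _ _
  rw [intervalIntegral.integral_add (i2.const_mul _) ((integrable_inv_sqrt.sub i2).const_mul _),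
    intervalIntegral.integral_const_mul, intervalIntegral.integral_const_mul,
    intervalIntegral.integral_sub integrable_inv_sqrt i2, integral_inv_sqrt,
    integral_sqrt_one_sub_sq]
  ring

lemma main_lim (p q F : ℝ → ℝ) (κ E r₀ A : ℝ) (hE : 0 < E) (hr₀ : 0 < r₀)
    (hp : ContinuousOn p (Metric.ball κ r₀)) (hq : ContinuousOn q (Metric.ball κ r₀))
    (hF : ContinuousOn F (Metric.ball κ r₀)) (hFpos : ∀ x ∈ Metric.ball κ r₀, 0 < F x)
    (hFd : ContDiffAt ℝ 1 F κ) (Am Ap : ℝ → ℝ) (hA : 0 < A) (hFA : F κ * A ^ 2 = 2 * E)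
    (hAm : Tendsto Am (𝓝 0) (𝓝 (-A))) (hAp : Tendsto Ap (𝓝 0) (𝓝 A))
    (hroot : ∀ᶠ ε in 𝓝 (0 : ℝ), 2 * E - F (κ - ε * Ap ε) * (Ap ε) ^ 2 = 0
      ∧ 2 * E - F (κ - ε * Am ε) * (Am ε) ^ 2 = 0) :
    Tendsto (fun ε => ∫ u in (Am ε)..(Ap ε),
        (p (κ - ε * u) * √(E - F (κ - ε * u) * u ^ 2 / 2)
          + q (κ - ε * u) * (u ^ 2 / 2) / √(E - F (κ - ε * u) * u ^ 2 / 2))) (𝓝 0)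
      (𝓝 ((A * p κ * √E + A ^ 3 * q κ / (2 * √E)) * (π / 2))) := by
  have hκ₀ : Metric.ball κ r₀ ∈ 𝓝 κ := Metric.ball_mem_nhds _ hr₀
  have hFκ : 0 < F κ := hFpos κ (Metric.mem_ball_self hr₀)
  have hpc := hp.continuousAt hκ₀
  have hqc := hq.continuousAt hκ₀
  have hFc := hF.continuousAt hκ₀
  -- Lipschitz constant and bounds
  obtain ⟨K, t, ht, hKt⟩ := (hFd.sqrt hFκ.ne').exists_lipschitzOnWith
  obtain ⟨m, hm0, hmF⟩ : ∃ m, 0 < m ∧ m < √(F κ) := exists_between (Real.sqrt_pos.2 hFκ)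
  have hsq : ∀ᶠ x in 𝓝 κ, m < √(F x) :=
    (hFc.sqrt).eventually (lt_mem_nhds hmF)
  obtain ⟨M, hMp, hMq⟩ : ∃ M, |p κ| < M ∧ |q κ| < M := by
    refine ⟨max |p κ| |q κ| + 1, ?_, ?_⟩
    · linarith [le_max_left |p κ| |q κ|]
    · linarith [le_max_right |p κ| |q κ|]
  have hM0 : 0 ≤ M := (abs_nonneg _).trans hMp.le
  have hpM : ∀ᶠ x in 𝓝 κ, |p x| < M := (hpc.abs).eventually (gt_mem_nhds hMp)
  have hqM : ∀ᶠ x in 𝓝 κ, |q x| < M := (hqc.abs).eventually (gt_mem_nhds hMq)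
  obtain ⟨r, hr, hball⟩ := Metric.eventually_nhds_iff_ball.1
    ((show ∀ᶠ x in 𝓝 κ, x ∈ t from ht).and (hsq.and (hpM.and (hqM.and
      (show ∀ᶠ x in 𝓝 κ, x ∈ Metric.ball κ r₀ from hκ₀)))))
  have hlip : ∀ x ∈ Metric.ball κ r, ∀ y ∈ Metric.ball κ r,
      |√(F x) - √(F y)| ≤ K * |x - y| := by
    intro x hx y hy
    have := hKt.dist_le_mul x (hball x hx).1 y (hball y hy).1
    simpa [Real.dist_eq] using this
  set B := A + 1 with hB
  have hB0 : 0 < B := by linarith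
  have habs : Tendsto (fun ε : ℝ => |ε|) (𝓝 0) (𝓝 0) := by
    simpa using (continuous_abs.tendsto (0 : ℝ))
  have ev1 : ∀ᶠ ε in 𝓝 (0 : ℝ), |ε| * B < r := by
    have := habs.mul_const B
    rw [zero_mul] at this
    exact this.eventually (gt_mem_nhds hr)
  have ev2 : ∀ᶠ ε in 𝓝 (0 : ℝ), K * |ε| * B < m / 2 := by
    have := (habs.const_mul (K : ℝ)).mul_const B
    rw [mul_zero, zero_mul] at this
    exact this.eventually (gt_mem_nhds (by linarith))
  have ev3 : ∀ᶠ ε in 𝓝 (0 : ℝ), Am ε < 0 := hAm.eventually (gt_mem_nhds (by linarith))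
  have ev4 : ∀ᶠ ε in 𝓝 (0 : ℝ), -B < Am ε := hAm.eventually (lt_mem_nhds (by linarith))
  have ev5 : ∀ᶠ ε in 𝓝 (0 : ℝ), Ap ε < B := hAp.eventually (gt_mem_nhds (by linarith))
  have ev6 : ∀ᶠ ε in 𝓝 (0 : ℝ), 0 < Ap ε := hAp.eventually (lt_mem_nhds (by linarith))
  set c : ℝ → ℝ := fun ε => (Ap ε + Am ε) / 2 with hc
  set h : ℝ → ℝ := fun ε => (Ap ε - Am ε) / 2 with hh
  have hcl : Tendsto c (𝓝 0) (𝓝 0) := by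
    have := (hAp.add hAm).div_const 2
    simpa using this
  have hhl : Tendsto h (𝓝 0) (𝓝 A) := by
    have := (hAp.sub hAm).div_const 2
    have e : (A - -A) / 2 = A := by ring
    rwa [e] at this
  -- facts valid for small ε and s in [-1,1]
  have hkey : ∀ᶠ ε in 𝓝 (0 : ℝ), 0 < h ε ∧ h ε ≤ B ∧ ∀ s ∈ Set.Icc (-1 : ℝ) 1,
      |c ε + h ε * s| ≤ B ∧ κ - ε * (c ε + h ε * s) ∈ Metric.ball κ r ∧
      m ^ 2 / 8 * (h ε ^ 2 * (1 - s ^ 2)) ≤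
        E - F (κ - ε * (c ε + h ε * s)) * (c ε + h ε * s) ^ 2 / 2 := by
    filter_upwards [ev1, ev2, ev3, ev4, ev5, ev6, hroot] with ε h1 h2 h3 h4 h5 h6 h7
    have hpos : 0 < h ε := by simp only [hh]; linarith
    refine ⟨hpos, by simp only [hh]; linarith, ?_⟩
    intro s hs
    have hu1 : (c ε + h ε * s) - Am ε = h ε * (1 + s) := by simp only [hc, hh]; ring
    have hu2 : Ap ε - (c ε + h ε * s) = h ε * (1 - s) := by simp only [hc, hh]; ring
    have hu3 : 0 ≤ h ε * (1 + s) := mul_nonneg hpos.le (by linarith [hs.1])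
    have hu4 : 0 ≤ h ε * (1 - s) := mul_nonneg hpos.le (by linarith [hs.2])
    have huB : |c ε + h ε * s| ≤ B := by rw [abs_le]; constructor <;> linarith
    refine ⟨huB, ?_, ?_⟩
    · rw [Metric.mem_ball, Real.dist_eq]
      have : κ - ε * (c ε + h ε * s) - κ = -(ε * (c ε + h ε * s)) := by ring
      rw [this, abs_neg, abs_mul]
      exact lt_of_le_of_lt (mul_le_mul_of_nonneg_left huB (abs_nonneg _)) h1
    · have := root_est F E κ r m K B ε (Am ε) (Ap ε) hm0
        (fun x hx => hFpos x (hball x hx).2.2.2.2) hlip (fun x hx => (hball x hx).2.1.le)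
        K.coe_nonneg h1 h2.le h3 h6 (by rw [abs_le]; constructor <;> linarith)
        (by rw [abs_le]; constructor <;> linarith) h7.2 h7.1 (c ε + h ε * s)
        (by linarith) (by linarith)
      rw [hu1, hu2] at this
      refine le_trans (le_of_eq ?_) this
      ring
  have hne1 : ∀ᵐ s : ℝ, s ≠ 1 := compl_mem_ae_iff.mpr (measure_singleton 1)
  have hIoc : Set.uIoc (-1 : ℝ) 1 = Set.Ioc (-1) 1 := Set.uIoc_of_le (by norm_num)
  have hpos1 : ∀ s ∈ Set.Ioo (-1 : ℝ) 1, 0 < 1 - s ^ 2 := by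
    intro s hs
    nlinarith [hs.1, hs.2]
  have hcv : ∀ ε, (∫ u in (Am ε)..(Ap ε),
        (p (κ - ε * u) * √(E - F (κ - ε * u) * u ^ 2 / 2)
          + q (κ - ε * u) * (u ^ 2 / 2) / √(E - F (κ - ε * u) * u ^ 2 / 2)))
      = ∫ s in (-1 : ℝ)..1, h ε *
        (p (κ - ε * (c ε + h ε * s)) * √(E - F (κ - ε * (c ε + h ε * s)) * (c ε + h ε * s) ^ 2 / 2)
          + q (κ - ε * (c ε + h ε * s)) * ((c ε + h ε * s) ^ 2 / 2)
            / √(E - F (κ - ε * (c ε + h ε * s)) * (c ε + h ε * s) ^ 2 / 2)) := by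
    intro ε
    have := intervalIntegral.mul_integral_comp_add_mul (a := -1) (b := 1) (f := fun u =>
        (p (κ - ε * u) * √(E - F (κ - ε * u) * u ^ 2 / 2)
          + q (κ - ε * u) * (u ^ 2 / 2) / √(E - F (κ - ε * u) * u ^ 2 / 2))) (c := h ε) (d := c ε)
    have e1 : c ε + h ε * (-1) = Am ε := by simp only [hc, hh]; ring
    have e2 : c ε + h ε * 1 = Ap ε := by simp only [hc, hh]; ring
    rw [e1, e2] at this
    rw [intervalIntegral.integral_const_mul, this]
  simp_rw [hcv]
  rw [← limit_integral]
  apply intervalIntegral.tendsto_integral_filter_of_dominated_convergence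
    (fun s => B * M * √E + 3 * M * B ^ 2 / (2 * m) * (1 / √(1 - s ^ 2)))
  · -- measurability
    filter_upwards [hkey] with ε hk
    obtain ⟨k1, k2, k3⟩ := hk
    rw [hIoc, ← restrict_Ioo_eq_restrict_Ioc]
    apply ContinuousOn.aestronglyMeasurable _ measurableSet_Ioo
    have hmaps : Set.MapsTo (fun s => κ - ε * (c ε + h ε * s)) (Set.Ioo (-1 : ℝ) 1)
        (Metric.ball κ r₀) :=
      fun s hs => (hball _ (k3 s (Set.Ioo_subset_Icc_self hs)).2.1).2.2.2.2
    have hx : ContinuousOn (fun s => κ - ε * (c ε + h ε * s)) (Set.Ioo (-1 : ℝ) 1) := by fun_prop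
    have hP := hp.comp hx hmaps
    have hQ := hq.comp hx hmaps
    have hFF := hF.comp hx hmaps
    have hu : ContinuousOn (fun s => c ε + h ε * s) (Set.Ioo (-1 : ℝ) 1) := by fun_prop
    have hS : ContinuousOn (fun s =>
        √(E - F (κ - ε * (c ε + h ε * s)) * (c ε + h ε * s) ^ 2 / 2)) (Set.Ioo (-1 : ℝ) 1) :=
      (continuousOn_const.sub ((hFF.mul (hu.pow 2)).div_const 2)).sqrt
    refine continuousOn_const.mul ((hP.mul hS).add ((hQ.mul ((hu.pow 2).div_const 2)).div hS ?_))
    intro s hs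
    refine (Real.sqrt_pos.2 (lt_of_lt_of_le ?_ (k3 s (Set.Ioo_subset_Icc_self hs)).2.2)).ne'
    have := hpos1 s hs
    positivity
  · -- bound
    filter_upwards [hkey] with ε hk
    obtain ⟨k1, k2, k3⟩ := hk
    filter_upwards [hne1] with s hs1 hs
    rw [hIoc] at hs
    have hs' : s ∈ Set.Ioo (-1 : ℝ) 1 := ⟨hs.1, lt_of_le_of_ne hs.2 hs1⟩
    obtain ⟨l1, l2, l3⟩ := k3 s (Set.Ioo_subset_Icc_self hs')
    obtain ⟨-, -, b1, b2, b3⟩ := hball _ l2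
    have hF0 := hFpos _ b3
    have hs0 := hpos1 s hs'
    generalize c ε + h ε * s = u at *
    generalize κ - ε * u = x at *
    have hSE : √(E - F x * u ^ 2 / 2) ≤ √E := by
      apply Real.sqrt_le_sqrt
      have : 0 ≤ F x * u ^ 2 / 2 := by positivity
      linarith
    have hSl : m / 3 * (h ε * √(1 - s ^ 2)) ≤ √(E - F x * u ^ 2 / 2) := by
      apply Real.le_sqrt_of_sq_le
      refine le_trans ?_ l3
      rw [mul_pow, mul_pow, Real.sq_sqrt hs0.le]
      have : 0 ≤ m ^ 2 * (h ε ^ 2 * (1 - s ^ 2)) := by positivity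
      nlinarith
    have hW : 0 < √(1 - s ^ 2) := Real.sqrt_pos.2 hs0
    have hu2 : u ^ 2 ≤ B ^ 2 := by
      rw [← sq_abs]; exact pow_le_pow_left₀ (abs_nonneg _) l1 2
    generalize √(E - F x * u ^ 2 / 2) = S at *
    generalize √(1 - s ^ 2) = W at *
    have hSpos : 0 < S := lt_of_lt_of_le (by positivity) hSl
    rw [Real.norm_eq_abs, abs_mul, abs_of_pos k1]
    have t1 : |p x * S| ≤ M * √E := by
      rw [abs_mul, abs_of_pos hSpos]
      exact mul_le_mul b1.le hSE hSpos.le hM0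
    have t2 : |q x * (u ^ 2 / 2) / S| ≤ M * (B ^ 2 / 2) / (m / 3 * (h ε * W)) := by
      rw [abs_div, abs_mul, abs_of_pos hSpos, abs_of_nonneg (by positivity : 0 ≤ u ^ 2 / 2)]
      apply div_le_div₀ (by positivity) _ (by positivity) hSl
      exact mul_le_mul b2.le (by linarith) (by positivity) hM0
    calc h ε * |p x * S + q x * (u ^ 2 / 2) / S|
        ≤ h ε * (M * √E + M * (B ^ 2 / 2) / (m / 3 * (h ε * W))) := by
          apply mul_le_mul_of_nonneg_left _ k1.le
          exact (abs_add_le _ _).trans (add_le_add t1 t2)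
      _ = h ε * (M * √E) + 3 * M * B ^ 2 / (2 * m) * (1 / W) := by
          have := k1.ne'
          field_simp
      _ ≤ B * M * √E + 3 * M * B ^ 2 / (2 * m) * (1 / W) := by
          have : h ε * (M * √E) ≤ B * (M * √E) :=
            mul_le_mul_of_nonneg_right k2 (by positivity)
          linarith
  · exact intervalIntegrable_const.add (integrable_inv_sqrt.const_mul _)
  · filter_upwards [hne1] with s hs1 hs
    rw [hIoc] at hs
    have hs' : s ∈ Set.Ioo (-1 : ℝ) 1 := ⟨hs.1, lt_of_le_of_ne hs.2 hs1⟩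
    have hs0 := hpos1 s hs'
    have hul : Tendsto (fun ε => c ε + h ε * s) (𝓝 0) (𝓝 (A * s)) := by
      simpa using hcl.add (hhl.mul_const s)
    have hxl : Tendsto (fun ε => κ - ε * (c ε + h ε * s)) (𝓝 0) (𝓝 κ) := by
      have := (tendsto_const_nhds (x := κ)).sub ((tendsto_id (α := ℝ) (x := 𝓝 0)).mul hul)
      simpa using this
    have hSl : Tendsto (fun ε => √(E - F (κ - ε * (c ε + h ε * s)) * (c ε + h ε * s) ^ 2 / 2))
        (𝓝 0) (𝓝 (√E * √(1 - s ^ 2))) := by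
      have := ((tendsto_const_nhds (x := E)).sub
        (((hFc.tendsto.comp hxl).mul (hul.pow 2)).div_const 2)).sqrt
      have e : E - F κ * (A * s) ^ 2 / 2 = E * (1 - s ^ 2) := by
        linear_combination (-s ^ 2 / 2) * hFA
      rw [e, Real.sqrt_mul hE.le] at this
      exact this
    have hW : 0 < √(1 - s ^ 2) := Real.sqrt_pos.2 hs0
    have hEs : 0 < √E := Real.sqrt_pos.2 hE
    have := hhl.mul (((hpc.tendsto.comp hxl).mul hSl).add
      (((hqc.tendsto.comp hxl).mul ((hul.pow 2).div_const 2)).div hSl (by positivity)))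
    refine (congrArg (Tendsto _ (𝓝 0)) (congrArg 𝓝 ?_)).mp this
    have hW2 : √(1 - s ^ 2) ^ 2 = 1 - s ^ 2 := Real.sq_sqrt hs0.le
    generalize √(1 - s ^ 2) = W at *
    have hs2 : s ^ 2 = 1 - W ^ 2 := by linarith
    rw [mul_pow, hs2]
    field_simp

/-- `G(ε, Ê, κ) = ε⁻²Φ(ε, Ê, κ)` tends, as `ε → 0`, to
`−2πÊ·d/dκ((R(κ)F(κ))^{−1/2})`; consequently if `G(·, Ê, κ)` vanishes for all small
`ε > 0` and all `κ`, then `R·F` is constant on `(a₁, a₂)`. -/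
theorem stmt_9 (a₁ a₂ : ℝ) (R F : ℝ → ℝ)
    (hR : ContDiffOn ℝ 2 R (Set.Ioo a₁ a₂)) (hF : ContDiffOn ℝ 2 F (Set.Ioo a₁ a₂))
    (hRpos : ∀ x ∈ Set.Ioo a₁ a₂, 0 < R x) (hFpos : ∀ x ∈ Set.Ioo a₁ a₂, 0 < F x)
    (E : ℝ) (hE : 0 < E) (Am Ap : ℝ → ℝ → ℝ)
    (hA : ∀ κ ∈ Set.Ioo a₁ a₂, ∃ δ > (0 : ℝ),
      ContinuousOn (fun ε => Am ε κ) (Set.Ioo (-δ) δ)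
      ∧ ContinuousOn (fun ε => Ap ε κ) (Set.Ioo (-δ) δ)
      ∧ Ap 0 κ = Real.sqrt (2 * E / F κ) ∧ Am 0 κ = -Real.sqrt (2 * E / F κ)
      ∧ ∀ ε ∈ Set.Ioo (-δ) δ,
          Am ε κ < Ap ε κ
          ∧ 2 * E - F (κ - ε * Ap ε κ) * (Ap ε κ) ^ 2 = 0
          ∧ 2 * E - F (κ - ε * Am ε κ) * (Am ε κ) ^ 2 = 0
          ∧ deriv (fun u => 2 * E - F (κ - ε * u) * u ^ 2) (Ap ε κ) ≠ 0
          ∧ deriv (fun u => 2 * E - F (κ - ε * u) * u ^ 2) (Am ε κ) ≠ 0)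
    (G : ℝ → ℝ → ℝ)
    (hG : ∀ ε κ : ℝ, G ε κ = Real.sqrt 2 * ∫ u in (Am ε κ)..(Ap ε κ),
      (deriv R (κ - ε * u) * Real.sqrt (E - F (κ - ε * u) * u ^ 2 / 2)
          / (R (κ - ε * u)) ^ ((3 : ℝ) / 2)
        + deriv F (κ - ε * u) * (u ^ 2 / 2)
          / (Real.sqrt (R (κ - ε * u)) * Real.sqrt (E - F (κ - ε * u) * u ^ 2 / 2)))) :
    (∀ κ ∈ Set.Ioo a₁ a₂,
      Tendsto (fun ε => G ε κ) (𝓝 0)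
        (𝓝 (-2 * π * E * deriv (fun x => (Real.sqrt (R x * F x))⁻¹) κ)))
    ∧ ((∀ κ ∈ Set.Ioo a₁ a₂, ∀ᶠ ε in 𝓝[>] (0 : ℝ), G ε κ = 0) →
        ∃ c : ℝ, ∀ κ ∈ Set.Ioo a₁ a₂, R κ * F κ = c) := by
  have hopen : IsOpen (Set.Ioo a₁ a₂) := isOpen_Ioo
  have hRd : ∀ x ∈ Set.Ioo a₁ a₂, DifferentiableAt ℝ R x := fun x hx =>
    (hR.contDiffAt (hopen.mem_nhds hx)).differentiableAt (by norm_num)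
  have hFd : ∀ x ∈ Set.Ioo a₁ a₂, DifferentiableAt ℝ F x := fun x hx =>
    (hF.contDiffAt (hopen.mem_nhds hx)).differentiableAt (by norm_num)
  have hdiff : ∀ x ∈ Set.Ioo a₁ a₂, HasDerivAt (fun x => (Real.sqrt (R x * F x))⁻¹)
      (-((deriv R x * F x + R x * deriv F x) / (2 * √(R x * F x))) / √(R x * F x) ^ 2) x := by
    intro x hx
    have hpos := mul_pos (hRpos x hx) (hFpos x hx)
    exact (((hRd x hx).hasDerivAt.mul (hFd x hx).hasDerivAt).sqrt hpos.ne').inv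
      (Real.sqrt_pos.2 hpos).ne'
  have hlim : ∀ κ ∈ Set.Ioo a₁ a₂,
      Tendsto (fun ε => G ε κ) (𝓝 0)
        (𝓝 (-2 * π * E * deriv (fun x => (Real.sqrt (R x * F x))⁻¹) κ)) := by
    intro κ hκ
    obtain ⟨δ, hδ, cm, cp, ep, em, hroots⟩ := hA κ hκ
    obtain ⟨r₀, hr₀, hsub⟩ := Metric.isOpen_iff.1 hopen κ hκ
    have hR0 := hRpos κ hκ
    have hF0 := hFpos κ hκ
    have hδn : Set.Ioo (-δ) δ ∈ 𝓝 (0 : ℝ) := Ioo_mem_nhds (by linarith) hδ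
    have hAp := (cp.continuousAt hδn).tendsto
    have hAm := (cm.continuousAt hδn).tendsto
    rw [ep] at hAp
    rw [em] at hAm
    have hRc := hR.continuousOn.mono hsub
    have hFc := hF.continuousOn.mono hsub
    have hR'c := (hR.continuousOn_deriv_of_isOpen hopen (by norm_num)).mono hsub
    have hF'c := (hF.continuousOn_deriv_of_isOpen hopen (by norm_num)).mono hsub
    have key := main_lim (fun x => deriv R x / (R x) ^ ((3 : ℝ) / 2))
      (fun x => deriv F x / √(R x)) F κ E r₀ (√(2 * E / F κ)) hE hr₀
      (hR'c.div (hRc.rpow_const fun x hx => Or.inl (hRpos x (hsub hx)).ne')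
        fun x hx => (Real.rpow_pos_of_pos (hRpos x (hsub hx)) _).ne')
      (hF'c.div hRc.sqrt fun x hx => (Real.sqrt_pos.2 (hRpos x (hsub hx))).ne')
      hFc (fun x hx => hFpos x (hsub hx))
      ((hF.contDiffAt (hopen.mem_nhds hκ)).of_le (by norm_num))
      (fun ε => Am ε κ) (fun ε => Ap ε κ) (Real.sqrt_pos.2 (by positivity))
      (by rw [Real.sq_sqrt (by positivity)]; field_simp)
      hAm hAp (by
        filter_upwards [hδn] with ε hε
        exact ⟨(hroots ε hε).2.1, (hroots ε hε).2.2.1⟩)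
    have key2 := key.const_mul (√2)
    have hGe : (fun ε => G ε κ) = _ := funext fun ε => hG ε κ
    rw [hGe]
    convert key2 using 2
    · congr 2
      funext ε
      congr 1
      · ring
      · rw [div_mul_eq_mul_div, div_div]
    · rw [(hdiff κ hκ).deriv, Real.sqrt_div (by positivity), Real.sqrt_mul hR0.le,
        Real.sqrt_mul (by norm_num : (0 : ℝ) ≤ 2)]
      have h32 : (R κ) ^ ((3 : ℝ) / 2) = √(R κ) ^ 3 := by
        rw [Real.sqrt_eq_rpow, ← Real.rpow_natCast, ← Real.rpow_mul hR0.le]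
        norm_num
      rw [h32]
      have sR : 0 < √(R κ) := Real.sqrt_pos.2 hR0
      have sF : 0 < √(F κ) := Real.sqrt_pos.2 hF0
      have sE : 0 < √E := Real.sqrt_pos.2 hE
      have s2 : 0 < √(2 : ℝ) := Real.sqrt_pos.2 (by norm_num)
      have qR : R κ = √(R κ) ^ 2 := (Real.sq_sqrt hR0.le).symm
      have qF : F κ = √(F κ) ^ 2 := (Real.sq_sqrt hF0.le).symm
      have qE : E = √E ^ 2 := (Real.sq_sqrt hE.le).symm
      have q2 : √(2 : ℝ) ^ 2 = 2 := Real.sq_sqrt (by norm_num)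
      have q4 : √(2 : ℝ) ^ 4 = 4 := by
        rw [show (4 : ℕ) = 2 * 2 from rfl, pow_mul, q2]; norm_num
      generalize √(R κ) = a at *
      generalize √(F κ) = b at *
      generalize √E = e at *
      generalize √(2 : ℝ) = w at *
      rw [qR, qF, qE]
      field_simp
      ring_nf
      simp only [q2, q4]
      ring
  refine ⟨hlim, fun hzero => ?_⟩
  have hd0 : ∀ κ ∈ Set.Ioo a₁ a₂, deriv (fun x => (Real.sqrt (R x * F x))⁻¹) κ = 0 := by
    intro κ hκ
    have l1 := (hlim κ hκ).mono_left (nhdsWithin_le_nhds (s := Set.Ioi 0))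
    have l2 : Tendsto (fun ε => G ε κ) (𝓝[>] 0) (𝓝 0) :=
      tendsto_const_nhds.congr' ((hzero κ hκ).mono fun ε h => h.symm)
    have := tendsto_nhds_unique l1 l2
    have hne : -2 * π * E ≠ 0 := by
      have := Real.pi_pos
      have : 0 < π * E := by positivity
      intro h; linarith
    exact (mul_eq_zero.1 this).resolve_left hne
  obtain ⟨a, ha⟩ := hopen.exists_is_const_of_deriv_eq_zero isPreconnected_Ioo
    (fun x hx => (hdiff x hx).differentiableAt.differentiableWithinAt) hd0
  refine ⟨a⁻¹ ^ 2, fun κ hκ => ?_⟩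
  rw [← ha κ hκ, inv_inv, Real.sq_sqrt (mul_pos (hRpos κ hκ) (hFpos κ hκ)).le]
end

section
/- Let F be a C³ positive real function on an open interval I ⊆ ℝ and λ ≠ 0 a real constant. Suppose that for all real numbers E > 0 and K, and all points a₋ < a₊ in I such that the function w(a) = 2E − F(a)(K − a)² satisfies w(a₋) = w(a₊) = 0, w'(a₋) ≠ 0, w'(a₊) ≠ 0, and w(a) > 0 for all a ∈ (a₋, a₊), the (convergent improper) integral Φ(E, K) = 2·∫_{a₋}^{a₊} F(a)^{3/2}(K − a) / (|λ|·√(2E − F(a)(K − a)²)) da equals 0. Then 6F'(a)³ − 6F(a)F'(a)F''(a) + F(a)²F'''(a) = 0 for all a ∈ I. -/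
open Real MeasureTheory

lemma taylor_aux (F F1 F2 : ℝ → ℝ) (K F3 : ℝ)
    (h1 : ∀ᶠ a in nhds K, HasDerivAt F (F1 a) a)
    (h2 : ∀ᶠ a in nhds K, HasDerivAt F1 (F2 a) a)
    (h3 : HasDerivAt F2 F3 K) :
    Filter.Tendsto (fun a => (F1 a - F1 K - F2 K * (a - K)) / (a - K) ^ 2)
      (nhdsWithin K {K}ᶜ) (nhds (F3 / 2)) ∧
    Filter.Tendsto (fun a => (F a - F K - F1 K * (a - K) - F2 K / 2 * (a - K) ^ 2) / (a - K) ^ 3)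
      (nhdsWithin K {K}ᶜ) (nhds (F3 / 6)) := by
  have hne : ∀ᶠ a in nhdsWithin K {K}ᶜ, a - K ≠ 0 := by
    filter_upwards [self_mem_nhdsWithin] with a ha
    exact sub_ne_zero.mpr ha
  have hs := hasDerivAt_iff_tendsto_slope.mp h3
  have hF1 : ContinuousAt F1 K := h2.self_of_nhds.continuousAt
  have hF : ContinuousAt F K := h1.self_of_nhds.continuousAt
  have A : Filter.Tendsto (fun a => (F1 a - F1 K - F2 K * (a - K)) / (a - K) ^ 2)
      (nhdsWithin K {K}ᶜ) (nhds (F3 / 2)) := by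
    refine HasDerivAt.lhopital_zero_nhdsNE (f' := fun a => F2 a - F2 K)
      (g' := fun a => 2 * (a - K)) ?_ ?_ ?_ ?_ ?_ ?_
    · filter_upwards [h2.filter_mono nhdsWithin_le_nhds] with a ha
      have := (ha.sub_const (F1 K)).fun_sub (((hasDerivAt_id a).sub_const K).const_mul (F2 K))
      simpa using this
    · filter_upwards with a
      have := ((hasDerivAt_id a).sub_const K).fun_pow 2
      simpa using this
    · filter_upwards [hne] with a ha
      simpa using ha
    · have : ContinuousAt (fun a => F1 a - F1 K - F2 K * (a - K)) K := by fun_prop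
      have := this.tendsto
      simp only [sub_self, mul_zero] at this
      exact this.mono_left nhdsWithin_le_nhds
    · have : ContinuousAt (fun a : ℝ => (a - K) ^ 2) K := by fun_prop
      have := this.tendsto
      simp only [sub_self, ne_eq, OfNat.ofNat_ne_zero, not_false_eq_true, zero_pow] at this
      exact this.mono_left nhdsWithin_le_nhds
    · refine (hs.div_const 2).congr' ?_
      filter_upwards [hne] with a ha
      rw [slope_def_field]; field_simp
  refine ⟨A, ?_⟩
  refine HasDerivAt.lhopital_zero_nhdsNE (f' := fun a => F1 a - F1 K - F2 K * (a - K))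
      (g' := fun a => 3 * (a - K) ^ 2) ?_ ?_ ?_ ?_ ?_ ?_
  · filter_upwards [h1.filter_mono nhdsWithin_le_nhds] with a ha
    have := ((ha.sub_const (F K)).fun_sub (((hasDerivAt_id a).sub_const K).const_mul (F1 K))).fun_sub
      ((((hasDerivAt_id a).sub_const K).fun_pow 2).const_mul (F2 K / 2))
    refine this.congr_deriv ?_
    simp only [id]; push_cast; ring
  · filter_upwards with a
    have := ((hasDerivAt_id a).sub_const K).fun_pow 3
    simpa using this
  · filter_upwards [hne] with a ha
    simpa using ha
  · have : ContinuousAt (fun a => F a - F K - F1 K * (a - K) - F2 K / 2 * (a - K) ^ 2) K := by fun_prop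
    have := this.tendsto
    simp only [sub_self, mul_zero, ne_eq, OfNat.ofNat_ne_zero, not_false_eq_true, zero_pow] at this
    exact this.mono_left nhdsWithin_le_nhds
  · have : ContinuousAt (fun a : ℝ => (a - K) ^ 3) K := by fun_prop
    have := this.tendsto
    simp only [sub_self, ne_eq, OfNat.ofNat_ne_zero, not_false_eq_true, zero_pow] at this
    exact this.mono_left nhdsWithin_le_nhds
  · have := (A.div_const 3)
    rw [show F3 / 2 / 3 = F3 / 6 by ring] at this
    refine this.congr' ?_
    filter_upwards [hne] with a ha
    field_simp

/-- the key expansion -/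
lemma expansion_aux (F F1 F2 : ℝ → ℝ) (K F3 : ℝ)
    (h1 : ∀ᶠ a in nhds K, HasDerivAt F (F1 a) a)
    (h2 : ∀ᶠ a in nhds K, HasDerivAt F1 (F2 a) a)
    (h3 : HasDerivAt F2 F3 K) (h0 ht m : ℝ) (hF0 : h0 ^ 2 = F K) (hm : 2 * h0 * ht = m)
    (hm' : 4 * m * F K ^ 2 = 3 * F1 K ^ 2 - 2 * F K * F2 K) :
    Filter.Tendsto (fun a => (4 * F a ^ 3 - ((h0 + ht * F a * (a - K) ^ 2)
        * (2 * F a + F1 a * (a - K))) ^ 2) / (a - K) ^ 3)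
      (nhdsWithin K {K}ᶜ)
      (nhds (-(4 / 3) * (6 * F1 K ^ 3 - 6 * F K * F1 K * F2 K + F K ^ 2 * F3))) := by
  obtain ⟨A, B⟩ := taylor_aux F F1 F2 K F3 h1 h2 h3
  set σ := fun a => (F1 a - F1 K - F2 K * (a - K)) / (a - K) ^ 2 with hσ
  set ρ := fun a => (F a - F K - F1 K * (a - K) - F2 K / 2 * (a - K) ^ 2) / (a - K) ^ 3 with hρ
  have hx : Filter.Tendsto (fun a : ℝ => a - K) (nhdsWithin K {K}ᶜ) (nhds 0) := by
    have : ContinuousAt (fun a : ℝ => (a - K)) K := by fun_prop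
    have := this.tendsto
    simp only [sub_self] at this
    exact this.mono_left nhdsWithin_le_nhds
  have hne : ∀ᶠ a in nhdsWithin K {K}ᶜ, a - K ≠ 0 := by
    filter_upwards [self_mem_nhdsWithin] with a ha
    exact sub_ne_zero.mpr ha
  have hlim := hx.prodMk_nhds (B.prodMk_nhds A)
  let q : ℝ × ℝ × ℝ → ℝ := fun p =>
    let x := p.1
    let r := p.2.1
    let s := p.2.2
    let t := 2 * r + s
    let U := F1 K + F2 K / 2 * x + r * x ^ 2
    let V := 2 * F1 K * (F2 K / 2 + r * x) + x * (F2 K / 2 + r * x) ^ 2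
    let M := 3 * F1 K + 2 * F2 K * x + t * x ^ 2
    let W := 6 * F1 K * (2 * F2 K + t * x) + x * (2 * F2 K + t * x) ^ 2
    let L := 2 * F K + x * M
    12 * F K ^ 2 * r + 12 * F K * V + 4 * U ^ 3 - F K * (4 * F K * t + W)
      - m * (U * L ^ 2 + F K * (4 * F K * M + x * M ^ 2)) - ht ^ 2 * (F K + x * U) ^ 2 * x * L ^ 2
  have hq : Continuous q := by
    simp only [q]
    fun_prop
  have hl := (hq.tendsto (0, F3 / 6, F3 / 2)).comp hlim
  have hv : q (0, F3 / 6, F3 / 2)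
      = -(4 / 3) * (6 * F1 K ^ 3 - 6 * F K * F1 K * F2 K + F K ^ 2 * F3) := by
    simp only [q]
    linear_combination (-4 * F1 K) * hm'
  rw [hv] at hl
  refine hl.congr' ?_
  filter_upwards [hne] with a ha
  have e1 : F a = F K + F1 K * (a - K) + F2 K / 2 * (a - K) ^ 2 + ρ a * (a - K) ^ 3 := by
    simp only [hρ]; field_simp; ring
  have e2 : F1 a = F1 K + F2 K * (a - K) + σ a * (a - K) ^ 2 := by
    simp only [hσ]; field_simp; ring
  rw [eq_div_iff (pow_ne_zero 3 ha)]
  have hL : F a = F a := rfl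
  simp only [Function.comp, q]
  rw [e1, e2]
  generalize ρ a = r
  generalize σ a = s
  generalize a - K = x
  linear_combination (2 * (F K + F1 K * x + F2 K / 2 * x ^ 2 + r * x ^ 3)
      + (F1 K + F2 K * x + s * x ^ 2) * x) ^ 2 * hF0
    + (F K + F1 K * x + F2 K / 2 * x ^ 2 + r * x ^ 3) * x ^ 2
      * (2 * (F K + F1 K * x + F2 K / 2 * x ^ 2 + r * x ^ 3)
      + (F1 K + F2 K * x + s * x ^ 2) * x) ^ 2 * hm + x ^ 2 * F K * hm'

lemma integral_ne (F F1 : ℝ → ℝ) (K am ap r c h0 ht ε : ℝ) (hc : 0 < c) (hr : 0 < r)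
    (hamK : am < K) (hKap : K < ap)
    (hd : ∀ a ∈ Set.Icc am ap, HasDerivAt F (F1 a) a)
    (hF1 : ContinuousOn F1 (Set.Icc am ap))
    (hpos : ∀ a ∈ Set.Icc am ap, 0 < F a)
    (hL : ∀ a ∈ Set.Icc am ap, 0 < 2 * F a + F1 a * (a - K))
    (hm : r ^ 2 - F am * (K - am) ^ 2 = 0)
    (hp : r ^ 2 - F ap * (K - ap) ^ 2 = 0)
    (hw : ∀ a ∈ Set.Ioo am ap, 0 < r ^ 2 - F a * (K - a) ^ 2)
    (hN : ∀ a ∈ Set.Ioo am ap, a ≠ K → 0 < ε * (F a ^ ((3 : ℝ) / 2) * (a - K)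
      - (h0 + ht * F a * (a - K) ^ 2) * (a - K) * (2 * F a + F1 a * (a - K)) / 2)) :
    (∫ a in am..ap, F a ^ ((3 : ℝ) / 2) * (K - a) / (c * √(r ^ 2 - F a * (K - a) ^ 2))) ≠ 0 := by
  have hlt : am < ap := hamK.trans hKap
  have hFc : ContinuousOn F (Set.Icc am ap) := fun a ha => (hd a ha).continuousAt.continuousWithinAt
  set q : ℝ → ℝ := fun a => √(r ^ 2 - F a * (K - a) ^ 2) with hq
  have hqc : ContinuousOn q (Set.Icc am ap) := by simp only [hq]; fun_prop
  have hqpos : ∀ a ∈ Set.Ioo am ap, 0 < q a := fun a ha => Real.sqrt_pos.mpr (hw a ha)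
  have hsF : ∀ a ∈ Set.Icc am ap, 0 < √(F a) := fun a ha => Real.sqrt_pos.mpr (hpos a ha)
  -- integrability of 1/q
  have hint1 : IntervalIntegrable
      (fun a => (2 * F a + F1 a * (a - K)) / (2 * √(F a)) / q a) volume am ap := by
    apply intervalIntegral.intervalIntegrable_deriv_of_nonneg
      (g := fun a => Real.arcsin (√(F a) * (a - K) / r))
    · rw [Set.uIcc_of_le hlt.le]
      refine Real.continuous_arcsin.comp_continuousOn ?_
      fun_prop
    · rw [min_eq_left hlt.le, max_eq_right hlt.le]
      intro a ha
      have ha' := Set.Ioo_subset_Icc_self ha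
      have h2 : (√(F a) * (a - K) / r) ^ 2 < 1 := by
        rw [div_pow, mul_pow, Real.sq_sqrt (hpos a ha').le, div_lt_one (by positivity)]
        nlinarith [hw a ha]
      have h3 := abs_lt.mp ((sq_lt_one_iff_abs_lt_one _).mp h2)
      have hg : HasDerivAt (fun a => √(F a) * (a - K) / r)
          ((F1 a / (2 * √(F a)) * (a - K) + √(F a) * 1) / r) a :=
        (((hd a ha').sqrt (hpos a ha').ne').fun_mul ((hasDerivAt_id a).sub_const K)).div_const r
      have := (Real.hasDerivAt_arcsin h3.1.ne' h3.2.ne).comp a hg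
      refine this.congr_deriv ?_
      symm
      have hqe : √(1 - (√(F a) * (a - K) / r) ^ 2) = q a / r := by
        rw [div_pow, mul_pow, Real.sq_sqrt (hpos a ha').le]
        rw [show 1 - F a * (a - K) ^ 2 / r ^ 2 = (r ^ 2 - F a * (K - a) ^ 2) / r ^ 2 by
          field_simp; ring, Real.sqrt_div (hw a ha).le, Real.sqrt_sq hr.le]
      rw [hqe]
      have h4 := hqpos a ha
      have h5 := hsF a ha'
      have h6 := Real.sq_sqrt (hpos a ha').le
      field_simp
      rw [h6]; ring
    · rw [min_eq_left hlt.le, max_eq_right hlt.le]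
      intro a ha
      have ha' := Set.Ioo_subset_Icc_self ha
      have h1 := hL a ha'
      have h4 := hqpos a ha
      have h5 := hsF a ha'
      positivity
  have hint : IntervalIntegrable (fun a => 1 / q a) volume am ap := by
    have h7 : ContinuousOn (fun a => 2 * √(F a) / (2 * F a + F1 a * (a - K))) (Set.uIcc am ap) := by
      rw [Set.uIcc_of_le hlt.le]
      apply ContinuousOn.div
      · fun_prop
      · fun_prop
      · intro a ha; exact (hL a ha).ne'
    refine (hint1.continuousOn_mul h7).congr ?_
    intro a ha
    rw [Set.uIoc_of_le hlt.le] at ha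
    have ha' := Set.Ioc_subset_Icc_self ha
    have h1 := hL a ha'
    have h5 := hsF a ha'
    simp only
    rw [div_div, div_mul_div_comm, show 2 * √(F a) * (2 * F a + F1 a * (a - K)) = (2 * F a + F1 a * (a - K)) * (2 * √(F a)) * 1 by ring,
      show (2 * F a + F1 a * (a - K)) * (2 * √(F a) * q a) =
        (2 * F a + F1 a * (a - K)) * (2 * √(F a)) * q a by ring, mul_div_mul_left _ _ (by positivity)]
  have hmul : ∀ f : ℝ → ℝ, ContinuousOn f (Set.Icc am ap) →
      IntervalIntegrable (fun a => f a / q a) volume am ap := by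
    intro f hf
    have := hint.continuousOn_mul (g := f) (by rwa [Set.uIcc_of_le hlt.le])
    simpa [div_eq_mul_inv] using this
  set Z : ℝ → ℝ := fun a => (h0 + ht * F a * (a - K) ^ 2) * (a - K) * (2 * F a + F1 a * (a - K)) / 2 with hZ
  have hZc : ContinuousOn Z (Set.Icc am ap) := by simp only [hZ]; fun_prop
  have hPc : ContinuousOn (fun a => F a ^ ((3 : ℝ) / 2) * (a - K)) (Set.Icc am ap) := by
    refine ContinuousOn.mul (hFc.rpow_const fun a ha => Or.inl (hpos a ha).ne') (by fun_prop)
  have hZ0 : ∫ a in am..ap, Z a / q a = 0 := by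
    have := intervalIntegral.integral_eq_sub_of_hasDerivAt_of_le hlt.le
      (f := fun a => -(h0 * q a + ht * (r ^ 2 * q a - q a ^ 3 / 3))) (f' := fun a => Z a / q a)
      (by fun_prop) ?_ (hmul Z hZc)
    · rw [this]
      simp only [hq, hm, hp]; simp
    · intro a ha
      have ha' := Set.Ioo_subset_Icc_self ha
      have h4 := hqpos a ha
      have hq2 : q a ^ 2 = r ^ 2 - F a * (K - a) ^ 2 := Real.sq_sqrt (hw a ha).le
      have hin : HasDerivAt (fun a => r ^ 2 - F a * (K - a) ^ 2)
          (-((a - K) * (2 * F a + F1 a * (a - K)))) a := by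
        have := ((hd a ha').fun_mul (((hasDerivAt_id a).const_sub K).fun_pow 2)).const_sub (r ^ 2)
        refine this.congr_deriv ?_
        simp only [id]; push_cast; ring
      have hqd : HasDerivAt q (-((a - K) * (2 * F a + F1 a * (a - K))) / (2 * q a)) a :=
        hin.sqrt (hw a ha).ne'
      have := ((hqd.const_mul h0).fun_add (((hqd.const_mul (r ^ 2)).fun_sub
        ((hqd.fun_pow 3).div_const 3)).const_mul ht)).fun_neg
      refine this.congr_deriv ?_
      symm
      simp only [hZ]
      have e : F a * (a - K) ^ 2 = r ^ 2 - q a ^ 2 := by rw [hq2]; ring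
      rw [mul_assoc ht, e]
      field_simp
      push_cast
      ring
  have hNc : ContinuousOn (fun a => ε * (F a ^ ((3 : ℝ) / 2) * (a - K) - Z a)) (Set.Icc am ap) :=
    continuousOn_const.mul (hPc.sub hZc)
  have hNi := hmul _ hNc
  have hKm : K ∈ Set.uIcc am ap := by
    rw [Set.uIcc_of_le hlt.le]; exact ⟨hamK.le, hKap.le⟩
  have i1 := hNi.mono_set (Set.uIcc_subset_uIcc_left hKm)
  have i2 := hNi.mono_set (Set.uIcc_subset_uIcc_right hKm)
  have hp1 := intervalIntegral.intervalIntegral_pos_of_pos_on i1 (fun a ha => by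
    have ha2 : a ∈ Set.Ioo am ap := ⟨ha.1, ha.2.trans hKap⟩
    exact div_pos (hN a ha2 ha.2.ne) (hqpos a ha2)) hamK
  have hp2 := intervalIntegral.intervalIntegral_pos_of_pos_on i2 (fun a ha => by
    have ha2 : a ∈ Set.Ioo am ap := ⟨hamK.trans ha.1, ha.2⟩
    exact div_pos (hN a ha2 ha.1.ne') (hqpos a ha2)) hKap
  have hsum := intervalIntegral.integral_add_adjacent_intervals i1 i2
  have hpos2 : 0 < ∫ a in am..ap, ε * (F a ^ ((3 : ℝ) / 2) * (a - K) - Z a) / q a := by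
    rw [← hsum]; exact add_pos hp1 hp2
  have hexp : (fun a => ε * (F a ^ ((3 : ℝ) / 2) * (a - K) - Z a) / q a)
      = fun a => (-ε * c) * (F a ^ ((3 : ℝ) / 2) * (K - a) / (c * q a)) - ε * (Z a / q a) := by
    funext a
    rw [← mul_div_assoc, mul_assoc (-ε) c, mul_left_comm (-ε) c, mul_div_mul_left _ _ hc.ne']
    ring
  have hi3 : IntervalIntegrable (fun a => F a ^ ((3 : ℝ) / 2) * (K - a) / (c * q a)) volume am ap := by
    have := (hmul _ hPc).const_mul (-1 / c)
    refine this.congr ?_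
    intro a _
    simp only
    rw [div_mul_div_comm]
    ring
  intro h0'
  rw [hexp, intervalIntegral.integral_sub (hi3.const_mul _) ((hmul Z hZc).const_mul _),
    intervalIntegral.integral_const_mul, intervalIntegral.integral_const_mul, hZ0, h0'] at hpos2
  simp at hpos2

/-- If, for all admissible energies `E > 0`, momenta `K` and pairs of
simple turning points `a₋ < a₊` in `I = (a₁,a₂)` of `w(a) = 2E − F(a)(K − a)²`, the
longitude difference `Φ(E,K) = 2∫_{a₋}^{a₊} F(a)^{3/2}(K−a)/(|λ|√(2E − F(a)(K−a)²)) da`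
vanishes, then `6F'³ − 6FF'F'' + F²F''' ≡ 0` on `I`. -/
theorem stmt_12 (a₁ a₂ : ℝ) (F : ℝ → ℝ)
    (hF : ContDiffOn ℝ 3 F (Set.Ioo a₁ a₂))
    (hFpos : ∀ x ∈ Set.Ioo a₁ a₂, 0 < F x)
    (lam : ℝ) (hlam : lam ≠ 0)
    (hΦ : ∀ E > (0 : ℝ), ∀ K am ap : ℝ,
      am ∈ Set.Ioo a₁ a₂ → ap ∈ Set.Ioo a₁ a₂ → am < ap →
      2 * E - F am * (K - am) ^ 2 = 0 →
      2 * E - F ap * (K - ap) ^ 2 = 0 →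
      deriv (fun a => 2 * E - F a * (K - a) ^ 2) am ≠ 0 →
      deriv (fun a => 2 * E - F a * (K - a) ^ 2) ap ≠ 0 →
      (∀ a ∈ Set.Ioo am ap, 0 < 2 * E - F a * (K - a) ^ 2) →
      2 * ∫ a in am..ap,
        (F a) ^ ((3 : ℝ) / 2) * (K - a)
          / (|lam| * Real.sqrt (2 * E - F a * (K - a) ^ 2)) = 0) :
    ∀ a ∈ Set.Ioo a₁ a₂,
      6 * (deriv F a) ^ 3 - 6 * F a * deriv F a * deriv (deriv F) a
        + (F a) ^ 2 * deriv (deriv (deriv F)) a = 0 := by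
  intro K hK
  by_contra hD
  have hI : IsOpen (Set.Ioo a₁ a₂) := isOpen_Ioo
  have hC1 : ContDiffOn ℝ 2 (deriv F) (Set.Ioo a₁ a₂) := hF.deriv_of_isOpen hI (by norm_num)
  have hC2 : ContDiffOn ℝ 1 (deriv (deriv F)) (Set.Ioo a₁ a₂) :=
    hC1.deriv_of_isOpen hI (by norm_num)
  have d0 : ∀ a ∈ Set.Ioo a₁ a₂, HasDerivAt F (deriv F a) a := fun a ha =>
    ((hF.differentiableOn (by norm_num)).differentiableAt (hI.mem_nhds ha)).hasDerivAt
  have d1 : ∀ a ∈ Set.Ioo a₁ a₂, HasDerivAt (deriv F) (deriv (deriv F) a) a := fun a ha =>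
    ((hC1.differentiableOn (by norm_num)).differentiableAt (hI.mem_nhds ha)).hasDerivAt
  have d2 : ∀ a ∈ Set.Ioo a₁ a₂, HasDerivAt (deriv (deriv F)) (deriv (deriv (deriv F)) a) a :=
    fun a ha =>
    ((hC2.differentiableOn (by norm_num)).differentiableAt (hI.mem_nhds ha)).hasDerivAt
  have hFK := hFpos K hK
  have hsK : 0 < √(F K) := Real.sqrt_pos.mpr hFK
  obtain ⟨h0, hh0⟩ : ∃ h0, h0 = √(F K) := ⟨_, rfl⟩
  have hh0pos : 0 < h0 := hh0 ▸ hsK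
  have hh02 : h0 ^ 2 = F K := by rw [hh0]; exact Real.sq_sqrt hFK.le
  obtain ⟨m, hm⟩ : ∃ m, 4 * m * F K ^ 2 = 3 * deriv F K ^ 2 - 2 * F K * deriv (deriv F) K :=
    ⟨(3 * deriv F K ^ 2 - 2 * F K * deriv (deriv F) K) / (4 * F K ^ 2), by field_simp⟩
  obtain ⟨ht, hht⟩ : ∃ ht, 2 * h0 * ht = m := ⟨m / (2 * h0), by field_simp⟩
  have hlim := expansion_aux F (deriv F) (deriv (deriv F)) K _
    (by filter_upwards [hI.mem_nhds hK] with a ha using d0 a ha)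
    (by filter_upwards [hI.mem_nhds hK] with a ha using d1 a ha) (d2 K hK) h0 ht m hh02 hht hm
  obtain ⟨c, hcdef⟩ : ∃ c, c = -(4 / 3) * (6 * deriv F K ^ 3 - 6 * F K * deriv F K * deriv (deriv F) K
    + F K ^ 2 * deriv (deriv (deriv F)) K) := ⟨_, rfl⟩
  have hc0 : c ≠ 0 := by rw [hcdef]; exact mul_ne_zero (by norm_num) hD
  rw [← hcdef] at hlim
  have hev1 := (hlim.const_mul c).eventually_const_lt (show 0 < c * c from mul_self_pos.mpr hc0)
  rw [eventually_nhdsWithin_iff] at hev1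
  have cF : ContinuousAt F K := (d0 K hK).continuousAt
  have cF1 : ContinuousAt (deriv F) K := (d1 K hK).continuousAt
  have hev2 : ∀ᶠ a in nhds K, 0 < 2 * F a + deriv F a * (a - K) := by
    have : ContinuousAt (fun a => 2 * F a + deriv F a * (a - K)) K := by fun_prop
    exact this.tendsto.eventually_const_lt (by simpa using hFK)
  have hev3 : ∀ᶠ a in nhds K, 0 < h0 + ht * F a * (a - K) ^ 2 := by
    have : ContinuousAt (fun a => h0 + ht * F a * (a - K) ^ 2) K := by fun_prop
    exact this.tendsto.eventually_const_lt (by simpa using hh0pos)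
  obtain ⟨δ, hδ, hball⟩ := Metric.eventually_nhds_iff.mp
    (((hev1.and hev2).and hev3).and (hI.mem_nhds hK))
  obtain ⟨η, hη, hηδ⟩ : ∃ η, 0 < η ∧ η < δ := ⟨δ / 2, by linarith, by linarith⟩
  have hb : ∀ a ∈ Set.Icc (K - η) (K + η), _ := fun a ha => hball (y := a) (by
    rw [Real.dist_eq, abs_lt]; constructor <;> linarith [ha.1, ha.2])
  obtain ⟨g, hg⟩ : ∃ g : ℝ → ℝ, g = fun a => √(F a) * (a - K) := ⟨_, rfl⟩
  have hgd : ∀ a ∈ Set.Icc (K - η) (K + η),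
      HasDerivAt g ((2 * F a + deriv F a * (a - K)) / (2 * √(F a))) a := by
    intro a ha
    have haI := (hb a ha).2
    have := ((d0 a haI).sqrt (hFpos a haI).ne').fun_mul ((hasDerivAt_id a).sub_const K)
    rw [hg]
    refine this.congr_deriv ?_
    have h5 := Real.sqrt_pos.mpr (hFpos a haI)
    have h6 := Real.sq_sqrt (hFpos a haI).le
    simp only [id]
    field_simp
    rw [h6]; ring
  have hgc : ContinuousOn g (Set.Icc (K - η) (K + η)) := fun a ha =>
    (hgd a ha).continuousAt.continuousWithinAt
  have hgm : StrictMonoOn g (Set.Icc (K - η) (K + η)) := by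
    refine strictMonoOn_of_deriv_pos (convex_Icc _ _) hgc ?_
    intro a ha
    have ha' := interior_subset ha
    rw [(hgd a ha').deriv]
    have h5 := Real.sqrt_pos.mpr (hFpos a (hb a ha').2)
    have := (hb a ha').1.1.2
    positivity
  have hgK : g K = 0 := by simp [hg]
  have mK : K ∈ Set.Icc (K - η) (K + η) := ⟨by linarith, by linarith⟩
  have mL : K - η ∈ Set.Icc (K - η) (K + η) := ⟨by linarith, by linarith⟩
  have mR : K + η ∈ Set.Icc (K - η) (K + η) := ⟨by linarith, by linarith⟩
  have hgl := hgm mL mK (by linarith)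
  have hgr := hgm mK mR (by linarith)
  rw [hgK] at hgl hgr
  obtain ⟨r, hr, hr1, hr2⟩ : ∃ r, 0 < r ∧ g (K - η) ≤ -r ∧ r ≤ g (K + η) :=
    ⟨min (-g (K - η)) (g (K + η)), lt_min (by linarith) hgr,
      by linarith [min_le_left (-g (K - η)) (g (K + η))], min_le_right _ _⟩
  obtain ⟨am, ham, hgam⟩ := intermediate_value_Icc (show K - η ≤ K by linarith)
    (hgc.mono (Set.Icc_subset_Icc_right (by linarith))) (show -r ∈ _ from ⟨hr1, by linarith⟩)
  obtain ⟨ap, hap, hgap⟩ := intermediate_value_Icc (show K ≤ K + η by linarith)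
    (hgc.mono (Set.Icc_subset_Icc_left (by linarith))) (show r ∈ _ from ⟨by linarith, hr2⟩)
  have hamK : am < K := lt_of_le_of_ne ham.2 (by rintro rfl; linarith)
  have hKap : K < ap := lt_of_le_of_ne hap.1 (by rintro rfl; linarith)
  have hsub : Set.Icc am ap ⊆ Set.Icc (K - η) (K + η) := Set.Icc_subset_Icc ham.1 hap.2
  have mam : am ∈ Set.Icc am ap := ⟨le_rfl, by linarith⟩
  have map' : ap ∈ Set.Icc am ap := ⟨by linarith, le_rfl⟩
  have hg2 : ∀ a ∈ Set.Icc am ap, g a ^ 2 = F a * (K - a) ^ 2 := by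
    intro a ha
    rw [hg]
    simp only
    rw [mul_pow, Real.sq_sqrt (hFpos a (hb a (hsub ha)).2).le]; ring
  have hwm : r ^ 2 - F am * (K - am) ^ 2 = 0 := by rw [← hg2 am mam, hgam]; ring
  have hwp : r ^ 2 - F ap * (K - ap) ^ 2 = 0 := by rw [← hg2 ap map', hgap]; ring
  have hw : ∀ a ∈ Set.Ioo am ap, 0 < r ^ 2 - F a * (K - a) ^ 2 := by
    intro a ha
    have ha' := Set.Ioo_subset_Icc_self ha
    rw [← hg2 a ha']
    have h1 := hgm (hsub mam) (hsub ha') ha.1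
    have h2 := hgm (hsub ha') (hsub map') ha.2
    rw [hgam] at h1
    rw [hgap] at h2
    nlinarith
  have hdw : ∀ a ∈ Set.Icc am ap, a ≠ K →
      deriv (fun a => 2 * (r ^ 2 / 2) - F a * (K - a) ^ 2) a ≠ 0 := by
    intro a ha hne
    have hb' := hb a (hsub ha)
    have h := ((d0 a hb'.2).fun_mul (((hasDerivAt_id a).const_sub K).fun_pow 2)).const_sub
      (2 * (r ^ 2 / 2))
    have h' : HasDerivAt (fun a => 2 * (r ^ 2 / 2) - F a * (K - a) ^ 2)
        (-((a - K) * (2 * F a + deriv F a * (a - K)))) a := by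
      refine h.congr_deriv ?_
      simp only [id]; push_cast; ring
    rw [h'.deriv]
    exact neg_ne_zero.mpr (mul_ne_zero (sub_ne_zero.mpr hne) hb'.1.1.2.ne')
  have e2 : 2 * (r ^ 2 / 2) = r ^ 2 := by ring
  have key := hΦ (r ^ 2 / 2) (by positivity) K am ap (hb am (hsub mam)).2 (hb ap (hsub map')).2
    (hamK.trans hKap) (by rw [e2]; exact hwm) (by rw [e2]; exact hwp) (hdw am mam hamK.ne)
    (hdw ap map' hKap.ne') (by rw [e2]; exact hw)
  rw [e2] at key
  refine integral_ne F (deriv F) K am ap r |lam| h0 ht c (abs_pos.mpr hlam) hr hamK hKap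
    (fun a ha => d0 a (hb a (hsub ha)).2)
    (fun a ha => (d1 a (hb a (hsub ha)).2).continuousAt.continuousWithinAt)
    (fun a ha => hFpos a (hb a (hsub ha)).2) (fun a ha => (hb a (hsub ha)).1.1.2)
    hwm hwp hw ?_ (by linarith)
  intro a ha hne
  have hb' := hb a (hsub (Set.Ioo_subset_Icc_self ha))
  have hLp := hb'.1.1.2
  have hHp := hb'.1.2
  have hT := hb'.1.1.1 hne
  have hFa := hFpos a hb'.2
  have hx : a - K ≠ 0 := sub_ne_zero.mpr hne
  obtain ⟨A, hA⟩ : ∃ A, A = F a ^ ((3 : ℝ) / 2) := ⟨_, rfl⟩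
  have hApos : 0 < A := by rw [hA]; positivity
  have hA2 : A ^ 2 = F a ^ 3 := by
    rw [hA, ← Real.rpow_natCast, ← Real.rpow_mul hFa.le, ← Real.rpow_natCast]
    norm_num
  rw [← hA]
  rw [← hA2] at hT
  generalize a - K = x at *
  obtain ⟨B, hB⟩ : ∃ B, B = (h0 + ht * F a * x ^ 2) * (2 * F a + deriv F a * x) := ⟨_, rfl⟩
  have hBpos : 0 < B := by rw [hB]; exact mul_pos hHp hLp
  rw [← hB] at hT
  rw [show c * (A * x - (h0 + ht * F a * x ^ 2) * x * (2 * F a + deriv F a * x) / 2)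
    = (c * ((4 * A ^ 2 - B ^ 2) / x ^ 3)) * x ^ 4 / (2 * (2 * A + B)) by
      rw [show (h0 + ht * F a * x ^ 2) * x * (2 * F a + deriv F a * x) = B * x by rw [hB]; ring]
      have : 2 * A + B ≠ 0 := by positivity
      field_simp
      ring]
  positivity
end

section
/- Let R and F be C¹ positive real functions, ε ∈ ℝ, κ ∈ ℝ, Ê > 0. Suppose A₋ < A₊ are real numbers with 2Ê − F(κ − εA₋)A₋² = 0 and 2Ê − F(κ − εA₊)A₊² = 0, the derivative of u ↦ 2Ê − F(κ − εu)u² nonzero at both A₋ and A₊, 2Ê − F(κ − εu)u² > 0 for all u ∈ (A₋, A₊), and R(κ − εu) > 0 for all u ∈ [A₋, A₊]. Consider the one-degree-of-freedom natural system ẋ = −R(κ − εx)·y, ẏ = −ε·R'(κ − εx)·y²/2 − ε·F'(κ − εx)·x²/2 + F(κ − εx)·x. Then there exists a C¹ solution (x, y) : ℝ → ℝ² with R(κ − εx(t))y(t)²/2 + F(κ − εx(t))x(t)²/2 = Ê for all t, whose x-component takes a value in [A₋, A₊]; for any such solution, x(ℝ) = [A₋, A₊], x is periodic, and the minimal positive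 period of x equals T = 2·∫_{A₋}^{A₊} du / (√(R(κ − εu)) · √(2Ê − F(κ − εu)u²)), the integral being a convergent improper integral. -/
open Real MeasureTheory

lemma aux_mul_zero {f k : ℝ → ℝ} {f' t : ℝ} (hf : HasDerivAt f f' t) (h0 : f t = 0)
    (hk : ContinuousAt k t) : HasDerivAt (fun s => f s * k s) (f' * k t) t := by
  rw [hasDerivAt_iff_tendsto_slope] at hf ⊢
  have h := hf.mul (hk.tendsto.mono_left (nhdsWithin_le_nhds (s := {t}ᶜ)))
  refine h.congr fun s => ?_
  simp only [slope_def_field, h0]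
  ring

lemma aux_sq_pos {q P : ℝ → ℝ} {P' t : ℝ} (hq : ContinuousAt q t) (hP : HasDerivAt P P' t)
    (hsq : ∀ s, q s ^ 2 = P s) (h0 : 0 < q t) : HasDerivAt q (P' / (2 * q t)) t := by
  have hP0 : P t ≠ 0 := by rw [← hsq]; positivity
  have h1 := hP.sqrt hP0
  have h2 : √(P t) = q t := by rw [← hsq, Real.sqrt_sq h0.le]
  rw [h2] at h1
  refine h1.congr_of_eventuallyEq ?_
  filter_upwards [hq.eventually (lt_mem_nhds h0)] with s hs
  rw [← hsq, Real.sqrt_sq (le_of_lt hs)]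

lemma aux_sq {q P : ℝ → ℝ} {P' t : ℝ} (hq : ContinuousAt q t) (hP : HasDerivAt P P' t)
    (hsq : ∀ s, q s ^ 2 = P s) (h0 : q t ≠ 0) : HasDerivAt q (P' / (2 * q t)) t := by
  rcases lt_or_gt_of_ne h0 with h | h
  · have h1 := (aux_sq_pos (q := fun s => - q s) hq.neg hP (fun s => by rw [← hsq]; ring)
      (by simpa using h)).neg
    have e : (-fun s => - q s) = q := by ext s; simp
    rw [e] at h1
    refine h1.congr_deriv ?_
    rw [mul_neg, div_neg, neg_neg]
  · exact aux_sq_pos hq hP hsq h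

lemma aux_g {G G' : ℝ → ℝ} {a b : ℝ} (hab : a < b) (hG : ∀ u, HasDerivAt G (G' u) u)
    (ha : G a = 0) (hb : G b = 0) (ha' : G' a ≠ 0) (hb' : G' b ≠ 0)
    (hpos : ∀ u ∈ Set.Ioo a b, 0 < G u) :
    ∃ g : ℝ → ℝ, Continuous g ∧ (∀ u, G u = (u - a) * (b - u) * g u) ∧
      (∀ u ∈ Set.Icc a b, 0 < g u) ∧ G' a = (b - a) * g a ∧ G' b = - ((b - a) * g b) := by
  have hGc : Continuous G := continuous_iff_continuousAt.2 fun u => (hG u).continuousAt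
  have hGd : Differentiable ℝ G := fun u => (hG u).differentiableAt
  let D := dslope G a
  have hDc : Continuous D := by
    rw [continuous_iff_continuousAt]
    intro u
    by_cases h : u = a
    · rw [h]; exact continuousAt_dslope_same.2 (hGd a)
    · exact (continuousAt_dslope_of_ne h).2 hGc.continuousAt
  have hGD : ∀ u, G u = (u - a) * D u := by
    intro u
    have := sub_smul_dslope G a u
    simp only [smul_eq_mul, ha, sub_zero] at this
    exact this.symm
  have hDb : D b = 0 := by
    have := hGD b
    rw [hb] at this
    rcases mul_eq_zero.1 this.symm with h | h
    · linarith
    · exact h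
  have hDd : DifferentiableAt ℝ D b := (differentiableAt_dslope_of_ne hab.ne').2 (hGd b)
  let D2 := dslope D b
  have hD2c : Continuous D2 := by
    rw [continuous_iff_continuousAt]
    intro u
    by_cases h : u = b
    · rw [h]; exact continuousAt_dslope_same.2 hDd
    · exact (continuousAt_dslope_of_ne h).2 hDc.continuousAt
  have hDD2 : ∀ u, D u = (u - b) * D2 u := by
    intro u
    have := sub_smul_dslope D b u
    simp only [smul_eq_mul, hDb, sub_zero] at this
    exact this.symm
  have hgc : Continuous (fun u => - D2 u) := hD2c.neg
  have hGg : ∀ u, G u = (u - a) * (b - u) * (- D2 u) := by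
    intro u; rw [hGD, hDD2]; ring
  have hga : G' a = (b - a) * (- D2 a) := by
    have h1 : HasDerivAt (fun u => (u - a) * ((b - u) * (- D2 u))) (1 * ((b - a) * (- D2 a))) a :=
      aux_mul_zero (f := fun u => u - a) (k := fun u => (b - u) * (- D2 u))
        ((hasDerivAt_id a).sub_const a) (by simp) (by fun_prop)
    have e : (fun u => (u - a) * ((b - u) * (- D2 u))) = G := by ext u; rw [hGg]; ring
    rw [e] at h1
    rw [(hG a).unique h1]; ring
  have hgb : G' b = - ((b - a) * (- D2 b)) := by
    have h1 : HasDerivAt (fun u => (u - b) * ((u - a) * D2 u)) (1 * ((b - a) * D2 b)) b :=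
      aux_mul_zero (f := fun u => u - b) (k := fun u => (u - a) * D2 u)
        ((hasDerivAt_id b).sub_const b) (by simp) (by fun_prop)
    have e : (fun u => (u - b) * ((u - a) * D2 u)) = G := by ext u; rw [hGg]; ring
    rw [e] at h1
    rw [(hG b).unique h1]; ring
  have hio : ∀ u ∈ Set.Ioo a b, 0 < - D2 u := by
    intro u hu
    have h1 := hpos u hu
    rw [hGg] at h1
    have : 0 < (u - a) * (b - u) := mul_pos (by linarith [hu.1]) (by linarith [hu.2])
    exact (mul_pos_iff_of_pos_left this).1 h1
  have hicc : ∀ u ∈ Set.Icc a b, 0 ≤ - D2 u := by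
    intro u hu
    rw [← closure_Ioo hab.ne] at hu
    have hcl : IsClosed {u | 0 ≤ - D2 u} := isClosed_le continuous_const hgc
    exact closure_minimal (fun u hu => (hio u hu).le) hcl hu
  refine ⟨fun u => - D2 u, hgc, hGg, ?_, hga, hgb⟩
  intro u hu
  refine lt_of_le_of_ne (hicc u hu) ?_
  intro h0
  replace h0 : 0 = - D2 u := h0
  rcases eq_or_lt_of_le hu.1 with h | h
  · subst h; rw [← h0] at hga; simp at hga; exact ha' hga
  rcases eq_or_lt_of_le hu.2 with h' | h'
  · subst h'; rw [← h0] at hgb; simp at hgb; exact hb' hgb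
  · exact (hio u ⟨h, h'⟩).ne h0

/-- angle parametrisation -/
noncomputable def auxU (a b θ : ℝ) : ℝ := (a + b) / 2 - (b - a) / 2 * Real.cos θ

noncomputable def auxK (g : ℝ → ℝ) (a b θ : ℝ) : ℝ := (√(g (auxU a b θ)))⁻¹

noncomputable def auxS (g : ℝ → ℝ) (a b θ : ℝ) : ℝ := ∫ s in (0:ℝ)..θ, auxK g a b s

lemma auxU_mem {a b : ℝ} (hab : a < b) (θ : ℝ) : auxU a b θ ∈ Set.Icc a b := by
  unfold auxU
  constructor
  · nlinarith [Real.cos_le_one θ]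
  · nlinarith [Real.neg_one_le_cos θ]

lemma auxU_cont (a b : ℝ) : Continuous (auxU a b) := by unfold auxU; fun_prop

lemma auxU_deriv (a b θ : ℝ) : HasDerivAt (auxU a b) ((b - a) / 2 * Real.sin θ) θ := by
  unfold auxU
  have := ((Real.hasDerivAt_cos θ).const_mul ((b - a) / 2)).const_sub ((a + b) / 2)
  refine this.congr_deriv ?_; ring

lemma auxU_surj {a b u : ℝ} (hab : a < b) (hu : u ∈ Set.Icc a b) :
    auxU a b (Real.arccos (((a + b) / 2 - u) / ((b - a) / 2))) = u := by
  unfold auxU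
  have hh : 0 < (b - a) / 2 := by linarith
  rw [Real.cos_arccos]
  · rw [mul_div_cancel₀ _ hh.ne']; ring
  · rw [le_div_iff₀ hh]; linarith [hu.2]
  · rw [div_le_iff₀ hh]; linarith [hu.1]

section
variable {g : ℝ → ℝ} {a b : ℝ} (hab : a < b) (hg : Continuous g)
  (hgp : ∀ u ∈ Set.Icc a b, 0 < g u)

lemma auxK_pos (hab : a < b) (hgp : ∀ u ∈ Set.Icc a b, 0 < g u) (θ : ℝ) : 0 < auxK g a b θ :=
  inv_pos.2 (Real.sqrt_pos.2 (hgp _ (auxU_mem hab θ)))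

lemma auxK_cont (hab : a < b) (hg : Continuous g) (hgp : ∀ u ∈ Set.Icc a b, 0 < g u) :
    Continuous (auxK g a b) := by
  unfold auxK
  refine Continuous.inv₀ ?_ fun θ => (Real.sqrt_pos.2 (hgp _ (auxU_mem hab θ))).ne'
  exact (hg.comp (auxU_cont a b)).sqrt

lemma auxK_per : Function.Periodic (auxK g a b) (2 * π) := by
  intro θ; simp [auxK, auxU]

lemma auxS_deriv (hab : a < b) (hg : Continuous g) (hgp : ∀ u ∈ Set.Icc a b, 0 < g u) (θ : ℝ) :
    HasDerivAt (auxS g a b) (auxK g a b θ) θ :=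
  intervalIntegral.integral_hasDerivAt_right ((auxK_cont hab hg hgp).intervalIntegrable _ _)
    ((auxK_cont hab hg hgp).stronglyMeasurableAtFilter _ _) (auxK_cont hab hg hgp).continuousAt

lemma auxS_mono (hab : a < b) (hg : Continuous g) (hgp : ∀ u ∈ Set.Icc a b, 0 < g u) :
    StrictMono (auxS g a b) :=
  strictMono_of_hasDerivAt_pos (fun θ => auxS_deriv hab hg hgp θ) (fun θ => auxK_pos hab hgp θ)

lemma auxS_add (hab : a < b) (hg : Continuous g) (hgp : ∀ u ∈ Set.Icc a b, 0 < g u) (θ : ℝ) :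
    auxS g a b (θ + 2 * π) = auxS g a b θ + auxS g a b (2 * π) := by
  have hi := fun x y => (auxK_cont hab hg hgp).intervalIntegrable (μ := volume) x y
  unfold auxS
  rw [← intervalIntegral.integral_add_adjacent_intervals (hi 0 θ) (hi θ (θ + 2 * π)),
    (auxK_per (g := g) (a := a) (b := b)).intervalIntegral_add_eq θ 0, zero_add]

lemma auxS_two (hab : a < b) (hg : Continuous g) (hgp : ∀ u ∈ Set.Icc a b, 0 < g u) :
    auxS g a b (2 * π) = 2 * auxS g a b π := by
  have hi := fun x y => (auxK_cont hab hg hgp).intervalIntegrable (μ := volume) x y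
  unfold auxS
  rw [← intervalIntegral.integral_add_adjacent_intervals (hi 0 π) (hi π (2 * π))]
  have h1 : ∫ s in (0:ℝ)..π, auxK g a b (2 * π - s) = ∫ s in π..(2 * π), auxK g a b s := by
    rw [intervalIntegral.integral_comp_sub_left]
    congr 1 <;> ring
  have h2 : ∀ s, auxK g a b (2 * π - s) = auxK g a b s := by
    intro s; simp [auxK, auxU]
  simp only [h2] at h1
  rw [← h1]; ring

lemma auxS_surj (hab : a < b) (hg : Continuous g) (hgp : ∀ u ∈ Set.Icc a b, 0 < g u) :
    Function.Surjective (auxS g a b) := by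
  have hc : Continuous (auxS g a b) :=
    continuous_iff_continuousAt.2 fun θ => (auxS_deriv hab hg hgp θ).continuousAt
  have hp : 0 < auxS g a b (2 * π) := by
    have := auxS_mono hab hg hgp (show (0:ℝ) < 2 * π by positivity)
    simpa [auxS] using this
  have hi := fun x y => (auxK_cont hab hg hgp).intervalIntegrable (μ := volume) x y
  exact hc.surjective
    (auxK_per.tendsto_atTop_intervalIntegral_of_pos hp (by positivity))
    (auxK_per.tendsto_atBot_intervalIntegral_of_pos hp (by positivity))

lemma auxU_image (hab : a < b) : auxU a b '' Set.Ioo 0 π = Set.Ioo a b := by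
  have hh : 0 < (b - a) / 2 := by linarith
  ext u
  constructor
  · rintro ⟨θ, hθ, rfl⟩
    have h1 : Real.cos θ < 1 := by
      have := Real.cos_lt_cos_of_nonneg_of_le_pi le_rfl hθ.2.le hθ.1
      simpa using this
    have h2 : -1 < Real.cos θ := by
      have := Real.cos_lt_cos_of_nonneg_of_le_pi hθ.1.le le_rfl hθ.2
      simpa using this
    unfold auxU
    constructor <;> nlinarith
  · intro hu
    refine ⟨_, ⟨?_, ?_⟩, auxU_surj hab ⟨hu.1.le, hu.2.le⟩⟩
    · rw [Real.arccos_pos, div_lt_iff₀ hh]; linarith [hu.1]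
    · refine lt_of_le_of_ne (Real.arccos_le_pi _) fun h => ?_
      rw [Real.arccos_eq_pi, div_le_iff₀ hh] at h
      linarith [hu.2]

lemma auxU_inj (hab : a < b) : Set.InjOn (auxU a b) (Set.Ioo 0 π) := by
  intro x hx y hy hxy
  unfold auxU at hxy
  have hh : (b - a) / 2 ≠ 0 := by linarith
  have : Real.cos x = Real.cos y := mul_left_cancel₀ hh (by linarith)
  exact Real.injOn_cos ⟨hx.1.le, hx.2.le⟩ ⟨hy.1.le, hy.2.le⟩ this

lemma aux_factor {G : ℝ → ℝ} (hGg : ∀ u, G u = (u - a) * (b - u) * g u) (θ : ℝ) :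
    G (auxU a b θ) = ((b - a) / 2 * Real.sin θ) ^ 2 * g (auxU a b θ) := by
  rw [hGg]
  congr 1
  unfold auxU
  have := Real.sin_sq_add_cos_sq θ
  linear_combination ((b - a) / 2) ^ 2 * (-this)

lemma aux_integral {G : ℝ → ℝ} (hab : a < b) (hg : Continuous g)
    (hgp : ∀ u ∈ Set.Icc a b, 0 < g u) (hGg : ∀ u, G u = (u - a) * (b - u) * g u) :
    IntervalIntegrable (fun u => (√(G u))⁻¹) volume a b ∧
      ∫ u in a..b, (√(G u))⁻¹ = auxS g a b π := by
  have hh : 0 < (b - a) / 2 := by linarith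
  have hd : ∀ θ ∈ Set.Ioo 0 π, HasDerivWithinAt (auxU a b) ((b - a) / 2 * Real.sin θ)
    (Set.Ioo 0 π) θ := fun θ _ => (auxU_deriv a b θ).hasDerivWithinAt
  have key : Set.EqOn (fun θ => |(b - a) / 2 * Real.sin θ| • (√(G (auxU a b θ)))⁻¹)
      (auxK g a b) (Set.Ioo 0 π) := by
    intro θ hθ
    have hs : 0 < (b - a) / 2 * Real.sin θ := mul_pos hh (Real.sin_pos_of_pos_of_lt_pi hθ.1 hθ.2)
    have hk := (Real.sqrt_pos.2 (hgp _ (auxU_mem hab θ)))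
    simp only [smul_eq_mul, auxK]
    rw [aux_factor hGg, Real.sqrt_mul (sq_nonneg _), Real.sqrt_sq hs.le, abs_of_pos hs, mul_inv,
      mul_inv_cancel_left₀ hs.ne']
  have hKi : IntegrableOn (auxK g a b) (Set.Ioo 0 π) := by
    have := (auxK_cont hab hg hgp).intervalIntegrable (μ := volume) 0 π
    rw [intervalIntegrable_iff_integrableOn_Ioo_of_le Real.pi_pos.le] at this
    exact this
  constructor
  · rw [intervalIntegrable_iff_integrableOn_Ioo_of_le hab.le, ← auxU_image hab,
      integrableOn_image_iff_integrableOn_abs_deriv_smul measurableSet_Ioo hd (auxU_inj hab)]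
    exact hKi.congr_fun key.symm measurableSet_Ioo
  · rw [intervalIntegral.integral_of_le hab.le, integral_Ioc_eq_integral_Ioo, ← auxU_image hab,
      integral_image_eq_integral_abs_deriv_smul measurableSet_Ioo hd (auxU_inj hab),
      setIntegral_congr_fun measurableSet_Ioo key, auxS,
      intervalIntegral.integral_of_le Real.pi_pos.le, integral_Ioc_eq_integral_Ioo]

lemma aux_exists {G G' : ℝ → ℝ} (hab : a < b) (hg : Continuous g)
    (hgp : ∀ u ∈ Set.Icc a b, 0 < g u) (hGg : ∀ u, G u = (u - a) * (b - u) * g u)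
    (hG : ∀ u, HasDerivAt G (G' u) u)
    (hga : G' a = (b - a) * g a) (hgb : G' b = - ((b - a) * g b)) :
    ∃ x v : ℝ → ℝ, (∀ t, HasDerivAt x (v t) t) ∧ (∀ t, HasDerivAt v (G' (x t) / 2) t) ∧
      (∀ t, v t ^ 2 = G (x t)) ∧ x 0 ∈ Set.Icc a b := by
  let e := (auxS_mono hab hg hgp).orderIsoOfSurjective _ (auxS_surj hab hg hgp)
  let θ : ℝ → ℝ := fun t => e.symm t
  have hSθ : ∀ t, auxS g a b (θ t) = t := fun t => e.apply_symm_apply t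
  have hθc : Continuous θ := e.symm.continuous
  have hpos : ∀ t, 0 < √(g (auxU a b (θ t))) := fun t => Real.sqrt_pos.2 (hgp _ (auxU_mem hab _))
  have hθd : ∀ t, HasDerivAt θ (√(g (auxU a b (θ t)))) t := by
    intro t
    have := HasDerivAt.of_local_left_inverse hθc.continuousAt (auxS_deriv hab hg hgp (θ t))
      (auxK_pos hab hgp _).ne' (Filter.Eventually.of_forall hSθ)
    simpa [auxK] using this
  let x : ℝ → ℝ := fun t => auxU a b (θ t)
  let k : ℝ → ℝ := fun t => √(g (x t))
  let v : ℝ → ℝ := fun t => ((b - a) / 2 * Real.sin (θ t)) * k t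
  have hxc : Continuous x := (auxU_cont a b).comp hθc
  have hkc : Continuous k := (hg.comp hxc).sqrt
  have hvc : Continuous v := by fun_prop
  have hx : ∀ t, HasDerivAt x (v t) t := fun t => (auxU_deriv a b (θ t)).comp t (hθd t)
  have hsq : ∀ t, v t ^ 2 = G (x t) := by
    intro t
    simp only [v, x, k]
    rw [aux_factor hGg, mul_pow, Real.sq_sqrt (hgp _ (auxU_mem hab _)).le]
  refine ⟨x, v, hx, ?_, hsq, auxU_mem hab _⟩
  intro t
  by_cases h0 : Real.sin (θ t) = 0
  · have h1 : HasDerivAt (fun s => (b - a) / 2 * Real.sin (θ s))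
        ((b - a) / 2 * (Real.cos (θ t) * k t)) t := ((hθd t).sin).const_mul _
    have h2 := aux_mul_zero h1 (by simp [h0]) hkc.continuousAt
    convert h2 using 1
    have hkk : k t * k t = g (x t) := Real.mul_self_sqrt (hgp _ (auxU_mem hab _)).le
    rcases (Real.sin_eq_zero_iff_cos_eq).1 h0 with hc | hc
    · have hxa : x t = a := by simp only [x, auxU, hc]; ring
      rw [hc, mul_assoc, one_mul, hkk, hxa, hga]; ring
    · have hxa : x t = b := by simp only [x, auxU, hc]; ring
      rw [hc, mul_assoc, neg_one_mul, neg_mul, hkk, hxa, hgb]; ring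
  · have hv0 : v t ≠ 0 := by
      have : (b - a) / 2 ≠ 0 := by linarith
      exact mul_ne_zero (mul_ne_zero this h0) (hpos t).ne'
    have h1 := aux_sq hvc.continuousAt ((hG (x t)).comp t (hx t)) hsq hv0
    convert h1 using 1
    field_simp

lemma aux_trap {G : ℝ → ℝ} {x v : ℝ → ℝ} (hab : a < b) (hg : Continuous g)
    (hgp : ∀ u ∈ Set.Icc a b, 0 < g u) (hGg : ∀ u, G u = (u - a) * (b - u) * g u)
    (hxc : Continuous x) (hsq : ∀ t, v t ^ 2 = G (x t)) (t₀ : ℝ) (ht₀ : x t₀ ∈ Set.Icc a b)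
    (t : ℝ) : x t ∈ Set.Icc a b := by
  have hnn : ∀ t, 0 ≤ G (x t) := fun t => by rw [← hsq]; positivity
  constructor
  · by_contra! h
    have h1 : ∀ᶠ u in nhdsWithin a (Set.Iio a), 0 < g u :=
      nhdsWithin_le_nhds (hg.continuousAt.eventually (lt_mem_nhds (hgp a ⟨le_rfl, hab.le⟩)))
    have h2 : ∀ᶠ u in nhdsWithin a (Set.Iio a), u ∈ Set.Ioo (x t) a := Ioo_mem_nhdsLT h
    obtain ⟨u, hu1, hu2⟩ := (h1.and h2).exists
    obtain ⟨s, rfl⟩ := mem_range_of_exists_le_of_exists_ge hxc ⟨t, hu2.1.le⟩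
      ⟨t₀, hu2.2.le.trans ht₀.1⟩
    have := hnn s
    rw [hGg] at this
    have h3 : (x s - a) * (b - x s) < 0 :=
      mul_neg_of_neg_of_pos (by linarith [hu2.2]) (by linarith [hu2.2])
    linarith [mul_neg_of_neg_of_pos h3 hu1]
  · by_contra! h
    have h1 : ∀ᶠ u in nhdsWithin b (Set.Ioi b), 0 < g u :=
      nhdsWithin_le_nhds (hg.continuousAt.eventually (lt_mem_nhds (hgp b ⟨hab.le, le_rfl⟩)))
    have h2 : ∀ᶠ u in nhdsWithin b (Set.Ioi b), u ∈ Set.Ioo b (x t) := Ioo_mem_nhdsGT h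
    obtain ⟨u, hu1, hu2⟩ := (h1.and h2).exists
    obtain ⟨s, rfl⟩ := mem_range_of_exists_le_of_exists_ge hxc 
      ⟨t₀, ht₀.2.trans hu2.1.le⟩ ⟨t, hu2.2.le⟩
    have := hnn s
    rw [hGg] at this
    have h3 : (x s - a) * (b - x s) < 0 :=
      mul_neg_of_pos_of_neg (by linarith [hu2.1]) (by linarith [hu2.1])
    linarith [mul_neg_of_neg_of_pos h3 hu1]

lemma aux_angle (c s : ℝ) (h : c ^ 2 + s ^ 2 = 1) : ∃ φ : ℝ, Real.cos φ = c ∧ Real.sin φ = s := by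
  have h1 : s ^ 2 = 1 - c ^ 2 := by linarith
  have hc1 : -1 ≤ c := by nlinarith
  have hc2 : c ≤ 1 := by nlinarith
  rcases le_total 0 s with hs | hs
  · refine ⟨Real.arccos c, Real.cos_arccos hc1 hc2, ?_⟩
    rw [Real.sin_arccos, ← h1, Real.sqrt_sq hs]
  · refine ⟨-Real.arccos c, by rw [Real.cos_neg, Real.cos_arccos hc1 hc2], ?_⟩
    rw [Real.sin_neg, Real.sin_arccos, ← h1, Real.sqrt_sq_eq_abs, abs_of_nonpos hs, neg_neg]

lemma aux_lift {G G' x v : ℝ → ℝ} (hab : a < b) (hg : Continuous g)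
    (hgp : ∀ u ∈ Set.Icc a b, 0 < g u) (hGg : ∀ u, G u = (u - a) * (b - u) * g u)
    (hga : G' a = (b - a) * g a) (hgb : G' b = - ((b - a) * g b))
    (hx : ∀ t, HasDerivAt x (v t) t) (hv : ∀ t, HasDerivAt v (G' (x t) / 2) t)
    (hsq : ∀ t, v t ^ 2 = G (x t)) (hmem : ∀ t, x t ∈ Set.Icc a b) :
    ∃ (ψ : ℝ → ℝ) (c : ℝ), ∀ t, x t = auxU a b (ψ t) ∧ auxS g a b (ψ t) = t + c := by
  have hh : 0 < (b - a) / 2 := by linarith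
  have hxc : Continuous x := continuous_iff_continuousAt.2 fun u => (hx u).continuousAt
  have hvc : Continuous v := continuous_iff_continuousAt.2 fun u => (hv u).continuousAt
  let k : ℝ → ℝ := fun t => √(g (x t))
  have hkc : Continuous k := (hg.comp hxc).sqrt
  have hkp : ∀ t, 0 < k t := fun t => Real.sqrt_pos.2 (hgp _ (hmem t))
  have hkk : ∀ t, k t ^ 2 = g (x t) := fun t => Real.sq_sqrt (hgp _ (hmem t)).le
  let C : ℝ → ℝ := fun t => ((a + b) / 2 - x t) / ((b - a) / 2)
  let Z : ℝ → ℝ := fun t => v t * ((b - a) / 2 * k t)⁻¹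
  have hZk : ∀ t, v t = Z t * ((b - a) / 2 * k t) := by
    intro t; simp only [Z]; rw [mul_assoc, inv_mul_cancel₀ (mul_pos hh (hkp t)).ne', mul_one]
  have hinv : Continuous (fun t => ((b - a) / 2 * k t)⁻¹) :=
    (continuous_const.mul hkc).inv₀ fun t => (mul_pos hh (hkp t)).ne'
  have hZc : Continuous Z := hvc.mul hinv
  have hCd : ∀ t, HasDerivAt C (- (Z t * k t)) t := by
    intro t
    have h1 := ((hx t).const_sub ((a + b) / 2)).div_const ((b - a) / 2)
    refine h1.congr_deriv ?_
    rw [div_eq_iff hh.ne', hZk t]; ring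
  have hxC : ∀ t, x t = (a + b) / 2 - (b - a) / 2 * C t := by
    intro t; simp only [C]; rw [mul_div_cancel₀ _ hh.ne']; ring
  have hsum : ∀ t, Z t ^ 2 = 1 - C t ^ 2 := by
    intro t
    have h1 := hsq t
    rw [hGg, hZk, ← hkk] at h1
    rw [hxC] at h1
    have h3 : ((b - a) / 2 * k t) ^ 2 ≠ 0 := pow_ne_zero _ (mul_pos hh (hkp t)).ne'
    apply mul_right_cancel₀ h3
    linear_combination h1
  have hZd : ∀ t, HasDerivAt Z (C t * k t) t := by
    intro t
    by_cases h0 : Z t = 0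
    · have hv0 : v t = 0 := by rw [hZk, h0, zero_mul]
      have h1 := aux_mul_zero (hv t) hv0 hinv.continuousAt
      refine h1.congr_deriv ?_
      have hk0 := (mul_pos hh (hkp t)).ne'
      rw [← div_eq_mul_inv, div_eq_iff hk0]
      have hC2 : C t ^ 2 = 1 := by have := hsum t; rw [h0] at this; linarith
      rcases (sq_eq_sq_iff_eq_or_eq_neg.1 (hC2.trans (one_pow 2).symm)) with hc | hc
      · have hxa : x t = a := by rw [hxC, hc]; ring
        have h5 := hkk t
        rw [hxa] at h5
        rw [hxa, hga, hc, ← h5]; ring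
      · have hxa : x t = b := by rw [hxC, hc]; ring
        have h5 := hkk t
        rw [hxa] at h5
        rw [hxa, hgb, hc, ← h5]; ring
    · have h1 := aux_sq hZc.continuousAt (((hCd t).pow 2).const_sub 1) hsum h0
      refine h1.congr_deriv ?_
      rw [div_eq_iff (by simpa using h0)]
      push_cast
      ring
  obtain ⟨φ₀, hφc, hφs⟩ := aux_angle (C 0) (Z 0) (by rw [hsum]; ring)
  let ψ : ℝ → ℝ := fun t => φ₀ + ∫ s in (0:ℝ)..t, k s
  have hψ : ∀ t, HasDerivAt ψ (k t) t := fun t =>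
    (intervalIntegral.integral_hasDerivAt_right (hkc.intervalIntegrable _ _)
      (hkc.stronglyMeasurableAtFilter _ _) hkc.continuousAt).const_add _
  have hψ0 : ψ 0 = φ₀ := by simp [ψ]
  have hW : ∀ t, C t * Real.cos (ψ t) + Z t * Real.sin (ψ t) = 1 := by
    have hd : ∀ t, HasDerivAt (fun t => C t * Real.cos (ψ t) + Z t * Real.sin (ψ t)) 0 t := by
      intro t
      have h1 := ((hCd t).mul (hψ t).cos).add ((hZd t).mul (hψ t).sin)
      refine h1.congr_deriv ?_; ring
    intro t
    have h2 := is_const_of_deriv_eq_zero (fun t => (hd t).differentiableAt) (fun t => (hd t).deriv)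
      t 0
    rw [h2, hψ0, hφc, hφs, ← sq, ← sq, hsum]; ring
  have hCcos : ∀ t, C t = Real.cos (ψ t) := by
    intro t
    have h1 := hW t
    have h2 := hsum t
    have h3 := Real.sin_sq_add_cos_sq (ψ t)
    have h4 : (C t - Real.cos (ψ t)) ^ 2 + (Z t - Real.sin (ψ t)) ^ 2 = 0 := by
      linear_combination h2 + h3 - 2 * h1
    nlinarith [sq_nonneg (C t - Real.cos (ψ t)), sq_nonneg (Z t - Real.sin (ψ t))]
  have hxU : ∀ t, x t = auxU a b (ψ t) := by
    intro t
    rw [auxU, ← hCcos, hxC]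
  refine ⟨ψ, auxS g a b (ψ 0), fun t => ⟨hxU t, ?_⟩⟩
  have hd : ∀ t, HasDerivAt (fun t => auxS g a b (ψ t) - t) 0 t := by
    intro t
    have h1 := ((auxS_deriv hab hg hgp (ψ t)).comp t (hψ t)).sub (hasDerivAt_id t)
    refine h1.congr_deriv ?_
    have hk0 := (hkp t).ne'
    rw [auxK, ← hxU]
    exact sub_eq_zero.2 (inv_mul_cancel₀ hk0)
  have h2 := is_const_of_deriv_eq_zero (fun t => (hd t).differentiableAt) (fun t => (hd t).deriv)
    t 0
  linarith

lemma aux_unique {G G' x v : ℝ → ℝ} (hab : a < b) (hg : Continuous g)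
    (hgp : ∀ u ∈ Set.Icc a b, 0 < g u) (hGg : ∀ u, G u = (u - a) * (b - u) * g u)
    (hga : G' a = (b - a) * g a) (hgb : G' b = - ((b - a) * g b))
    (hx : ∀ t, HasDerivAt x (v t) t) (hv : ∀ t, HasDerivAt v (G' (x t) / 2) t)
    (hsq : ∀ t, v t ^ 2 = G (x t)) (hmem : ∃ t, x t ∈ Set.Icc a b) :
    Set.range x = Set.Icc a b ∧ Function.Periodic x (2 * auxS g a b π) ∧
      ∀ T : ℝ, 0 < T → Function.Periodic x T → 2 * auxS g a b π ≤ T := by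
  have hxc : Continuous x := continuous_iff_continuousAt.2 fun u => (hx u).continuousAt
  obtain ⟨t₀, ht₀⟩ := hmem
  have hmem := aux_trap hab hg hgp hGg hxc hsq t₀ ht₀
  obtain ⟨ψ, c, hψ⟩ := aux_lift hab hg hgp hGg hga hgb hx hv hsq hmem
  have hmono := auxS_mono hab hg hgp
  have hsurj : ∀ φ, ∃ t, ψ t = φ := by
    intro φ
    refine ⟨auxS g a b φ - c, hmono.injective ?_⟩
    rw [(hψ _).2]; ring
  rw [← auxS_two hab hg hgp]
  refine ⟨?_, ?_, ?_⟩
  · ext u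
    constructor
    · rintro ⟨t, rfl⟩; exact hmem t
    · intro hu
      obtain ⟨t, ht⟩ := hsurj (Real.arccos (((a + b) / 2 - u) / ((b - a) / 2)))
      exact ⟨t, by rw [(hψ t).1, ht, auxU_surj hab hu]⟩
  · intro t
    have h1 : ψ (t + auxS g a b (2 * π)) = ψ t + 2 * π := by
      apply hmono.injective
      rw [(hψ _).2, auxS_add hab hg hgp, (hψ _).2]; ring
    rw [(hψ _).1, (hψ t).1, h1]
    simp [auxU]
  · intro T hT hper
    obtain ⟨t, ht⟩ := hsurj 0
    have h1 := hper t
    rw [(hψ _).1, (hψ t).1, ht] at h1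
    have hh : (b - a) / 2 ≠ 0 := by linarith
    have h2 : Real.cos (ψ (t + T)) = 1 := by
      unfold auxU at h1
      rw [Real.cos_zero] at h1
      exact mul_left_cancel₀ hh (by linarith)
    have h3 : 0 < ψ (t + T) := by
      rw [← hmono.lt_iff_lt, ← ht, (hψ _).2, (hψ _).2]; linarith
    obtain ⟨n, hn⟩ := (Real.cos_eq_one_iff _).1 h2
    have hpi := Real.pi_pos
    have hn1 : 1 ≤ n := by
      by_contra! hlt
      have : (n : ℝ) ≤ 0 := by exact_mod_cast (by omega : n ≤ 0)
      nlinarith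
    have hn2 : (1 : ℝ) ≤ n := by exact_mod_cast hn1
    have h4 : 2 * π ≤ ψ (t + T) := by rw [← hn]; nlinarith
    have h5 := hmono.monotone h4
    rw [(hψ _).2] at h5
    have h6 := (hψ t).2
    rw [ht] at h6
    simp [auxS] at h6
    linarith
end

/-- The reduced one-degree-of-freedom system
`ẋ = −R(κ−εx)y`, `ẏ = −εR'(κ−εx)y²/2 − εF'(κ−εx)x²/2 + F(κ−εx)x` has, on the energy
level `Ê` with simple turning points `A₋ < A₊`, a solution whose `x`-component meets
`[A₋, A₊]`; any such solution has `x(ℝ) = [A₋, A₊]`, `x` periodic with minimal positive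
period `T = 2∫_{A₋}^{A₊} du/(√(R(κ−εu))√(2Ê−F(κ−εu)u²))` (a convergent improper
integral). -/
theorem stmt_16 (R F : ℝ → ℝ) (hR : ContDiff ℝ 1 R) (hF : ContDiff ℝ 1 F)
    (hRpos : ∀ x : ℝ, 0 < R x) (hFpos : ∀ x : ℝ, 0 < F x)
    (ε κ E : ℝ) (hE : 0 < E) (Am Ap : ℝ) (hlt : Am < Ap)
    (hrootm : 2 * E - F (κ - ε * Am) * Am ^ 2 = 0)
    (hrootp : 2 * E - F (κ - ε * Ap) * Ap ^ 2 = 0)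
    (hsimplem : deriv (fun u => 2 * E - F (κ - ε * u) * u ^ 2) Am ≠ 0)
    (hsimplep : deriv (fun u => 2 * E - F (κ - ε * u) * u ^ 2) Ap ≠ 0)
    (hwpos : ∀ u ∈ Set.Ioo Am Ap, 0 < 2 * E - F (κ - ε * u) * u ^ 2)
    (hRpos' : ∀ u ∈ Set.Icc Am Ap, 0 < R (κ - ε * u)) :
    IntervalIntegrable
      (fun u => (Real.sqrt (R (κ - ε * u)) * Real.sqrt (2 * E - F (κ - ε * u) * u ^ 2))⁻¹)
      volume Am Ap
    ∧ (∃ x y : ℝ → ℝ,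
        (∀ t : ℝ, HasDerivAt x (-(R (κ - ε * x t)) * y t) t)
        ∧ (∀ t : ℝ, HasDerivAt y
            (-ε * deriv R (κ - ε * x t) * (y t) ^ 2 / 2
              - ε * deriv F (κ - ε * x t) * (x t) ^ 2 / 2
              + F (κ - ε * x t) * x t) t)
        ∧ (∀ t : ℝ, R (κ - ε * x t) * (y t) ^ 2 / 2 + F (κ - ε * x t) * (x t) ^ 2 / 2 = E)
        ∧ (∃ t₀ : ℝ, x t₀ ∈ Set.Icc Am Ap))
    ∧ (∀ x y : ℝ → ℝ,
        (∀ t : ℝ, HasDerivAt x (-(R (κ - ε * x t)) * y t) t) →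
        (∀ t : ℝ, HasDerivAt y
            (-ε * deriv R (κ - ε * x t) * (y t) ^ 2 / 2
              - ε * deriv F (κ - ε * x t) * (x t) ^ 2 / 2
              + F (κ - ε * x t) * x t) t) →
        (∀ t : ℝ, R (κ - ε * x t) * (y t) ^ 2 / 2 + F (κ - ε * x t) * (x t) ^ 2 / 2 = E) →
        (∃ t₀ : ℝ, x t₀ ∈ Set.Icc Am Ap) →
        Set.range x = Set.Icc Am Ap
        ∧ Function.Periodic x
            (2 * ∫ u in Am..Ap,
              (Real.sqrt (R (κ - ε * u)) * Real.sqrt (2 * E - F (κ - ε * u) * u ^ 2))⁻¹)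
        ∧ (∀ T : ℝ, 0 < T → Function.Periodic x T →
            2 * ∫ u in Am..Ap,
              (Real.sqrt (R (κ - ε * u)) * Real.sqrt (2 * E - F (κ - ε * u) * u ^ 2))⁻¹
              ≤ T)) := by
  let r : ℝ → ℝ := fun u => R (κ - ε * u)
  let W : ℝ → ℝ := fun u => 2 * E - F (κ - ε * u) * u ^ 2
  let r' : ℝ → ℝ := fun u => - ε * deriv R (κ - ε * u)
  let W' : ℝ → ℝ := fun u => ε * deriv F (κ - ε * u) * u ^ 2 - 2 * (F (κ - ε * u) * u)
  have hlin : ∀ u : ℝ, HasDerivAt (fun u => κ - ε * u) (-ε) u := fun u => by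
    simpa using ((hasDerivAt_id u).const_mul ε).const_sub κ
  have hRd : ∀ u, HasDerivAt R (deriv R u) u := fun u =>
    ((hR.differentiable one_ne_zero) u).hasDerivAt
  have hFd : ∀ u, HasDerivAt F (deriv F u) u := fun u =>
    ((hF.differentiable one_ne_zero) u).hasDerivAt
  have hr : ∀ u, HasDerivAt r (r' u) u := fun u =>
    ((hRd (κ - ε * u)).comp u (hlin u)).congr_deriv (by simp only [r']; ring)
  have hW : ∀ u, HasDerivAt W (W' u) u := fun u => by
    have h1 : HasDerivAt (fun u => F (κ - ε * u)) (deriv F (κ - ε * u) * -ε) u :=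
      (hFd (κ - ε * u)).comp u (hlin u)
    have h2 : HasDerivAt (fun u : ℝ => u ^ 2) (2 * u) u := by
      simpa using hasDerivAt_pow 2 u
    exact ((h1.mul h2).const_sub (2 * E)).congr_deriv (by simp only [W']; ring)
  have hrp : ∀ u, 0 < r u := fun u => hRpos _
  let G : ℝ → ℝ := fun u => r u * W u
  let G' : ℝ → ℝ := fun u => r' u * W u + r u * W' u
  have hG : ∀ u, HasDerivAt G (G' u) u := fun u => (hr u).mul (hW u)
  have hWm : W Am = 0 := hrootm
  have hWp : W Ap = 0 := hrootp
  have hWm' : W' Am ≠ 0 := by rw [← (hW Am).deriv]; exact hsimplem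
  have hWp' : W' Ap ≠ 0 := by rw [← (hW Ap).deriv]; exact hsimplep
  obtain ⟨g, hg, hGg, hgp, hga, hgb⟩ := aux_g (G := G) (G' := G') hlt hG (by simp [G, hWm])
    (by simp [G, hWp]) (by simp [G', hWm, hWm', (hrp Am).ne'])
    (by simp [G', hWp, hWp', (hrp Ap).ne'])
    (fun u hu => mul_pos (hrp u) (hwpos u hu))
  have hfun : (fun u => (Real.sqrt (R (κ - ε * u)) *
      Real.sqrt (2 * E - F (κ - ε * u) * u ^ 2))⁻¹) = fun u => (√(G u))⁻¹ := by
    ext u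
    rw [← Real.sqrt_mul (hRpos _).le]
  rw [hfun]
  obtain ⟨hint, hval⟩ := aux_integral hlt hg hgp hGg
  rw [hval]
  refine ⟨hint, ?_, ?_⟩
  · obtain ⟨x, v, hx, hv, hsq, h0⟩ := aux_exists hlt hg hgp hGg hG hga hgb
    have hen : ∀ t, r (x t) * (-(v t) / r (x t)) ^ 2 = W (x t) := by
      intro t
      have h1 := hsq t
      have h2 := (hrp (x t)).ne'
      simp only [G] at h1
      rw [div_pow, neg_sq, h1]
      field_simp
    refine ⟨x, fun t => -(v t) / r (x t), ?_, ?_, ?_, 0, h0⟩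
    · intro t
      refine (hx t).congr_deriv ?_
      have h2 : R (κ - ε * x t) ≠ 0 := (hRpos _).ne'
      simp only [r]
      field_simp
    · intro t
      have h2 := (hrp (x t)).ne'
      have h3 := ((hv t).neg).div ((hr (x t)).comp t (hx t)) h2
      refine h3.congr_deriv ?_
      have h4 : -ε * deriv R (κ - ε * x t) * (-(v t) / r (x t)) ^ 2 / 2
          - ε * deriv F (κ - ε * x t) * (x t) ^ 2 / 2
          + F (κ - ε * x t) * x t = r' (x t) * (-(v t) / r (x t)) ^ 2 / 2 - W' (x t) / 2 := by
        simp only [r', W']; ring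
      refine Eq.trans ?_ h4.symm
      have h1 := hsq t
      simp only [G] at h1
      simp only [G', Function.comp, Pi.neg_apply]
      rw [div_pow, neg_sq, h1]
      field_simp
      linear_combination 2 * r' (x t) * h1
    · intro t
      have h1 := hen t
      simp only [r, W] at h1 ⊢
      linarith
  · intro x y hx hy hen hmem
    have hW2 : ∀ t, r (x t) * y t ^ 2 = W (x t) := by
      intro t
      have := hen t
      simp only [r, W]
      linarith
    refine aux_unique (v := fun t => -(r (x t)) * y t) hlt hg hgp hGg hga hgb hx ?_ ?_ hmem
    · intro t
      have h1 := (((hr (x t)).comp t (hx t)).neg).mul (hy t)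
      refine h1.congr_deriv ?_
      have h4 : -ε * deriv R (κ - ε * x t) * (y t) ^ 2 / 2
          - ε * deriv F (κ - ε * x t) * (x t) ^ 2 / 2
          + F (κ - ε * x t) * x t = r' (x t) * (y t) ^ 2 / 2 - W' (x t) / 2 := by
        simp only [r', W']; ring
      rw [h4]
      have h5 : R (κ - ε * x t) = r (x t) := rfl
      simp only [G', Function.comp, Pi.neg_apply, h5]
      linear_combination (r' (x t) / 2) * hW2 t
    · intro t
      simp only [G]
      rw [← hW2]; ring
end
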